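/- arXiv:1904.03104 — 2 statements merged into one kernel-verified Lean document; each statement's English description precedes it below -/
import Mathlib

section
/- Let $q$ be a prime power, let $n,k$ be integers with $1\le k\le n-1$, let $s,h$ be integers with $\gcd(s,n)=1$, and let $\eta\in\mathbb F_{q^n}$ satisfy $\eta\ne 0$ and $N_{q^n/q}(\eta)\neq(-1)^{nk}$. Let $$\mathcal H_{k,s}(\eta,h)=\{a_0x+a_1x^{q^s}+\cdots+a_{k-1}x^{q^{s(k-1)}}+a_0^{q^h}\eta\, x^{q^{sk}} : a_0,\dots,a_{k-1}\in\mathbb F_{q^n}\}$$ be the generalized twisted Gabidulin code, regarded as a set of $\mathbb F_q$-linear maps of $\mathbb F_{q^n}$ to itself (exponents of $q$ are read modulo $n$). For a code $\mathcal C$ of such maps let $L(\mathcal C)=\{\varphi\in\mathrm{End}_{\mathbb F_q}(\mathbb F_{q^n}):\varphi\circ f\in\mathcal C\text{ for all }f\in\mathcal C\}$ be its left idealiser and $R(\mathcal C)=\{\varphi\in\mathrm{End}_{\mathbb F_q}(\mathbb F_{q^n}): f\circ\varphi\in\mathcal C\text{ for all }f\in\mathcal C\}$ its right idealiser. Then,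 as $\mathbb F_q$-algebras, $$L(\mathcal H_{k,s}(\eta,h))\simeq\mathbb F_{q^{\gcd(n,h)}}\quad\text{unless } k\in\{1,n-1\}\text{ and } h\equiv sk \pmod n,$$ $$R(\mathcal H_{k,s}(\eta,h))\simeq\mathbb F_{q^{\gcd(n,sk-h)}}\quad\text{unless } k\in\{1,n-1\}\text{ and } h\equiv 0 \pmod n.$$ In each of the two exceptional cases the idealiser in question is isomorphic to $\mathbb F_{q^n}$. -/
section TwistedGabidulin

variable (Fq F : Type*) [Field Fq] [Fintype Fq] [Field F] [Finite F] [Algebra Fq F]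

/-- For `m : ℤ`, the automorphism `x ↦ x ^ (q ^ m)` of `F` over `Fq`, where `q = |Fq|`: the `m`-th
power of the Frobenius automorphism in the Galois group (so `q ^ m` makes sense for every integer
`m`, and depends only on `m` modulo the degree of `F` over `Fq`). -/
noncomputable def qFrob (m : ℤ) : F ≃ₐ[Fq] F :=
  FiniteField.frobeniusAlgEquivOfAlgebraic Fq F ^ m

theorem qFrob_natCast_apply (m : ℕ) (x : F) :
    qFrob Fq F (m : ℤ) x = x ^ (Fintype.card Fq ^ m) := by
  rw [qFrob, zpow_natCast, AlgEquiv.coe_pow,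
    FiniteField.coe_frobeniusAlgEquivOfAlgebraic_iterate]

variable {F}

/-- The generalized twisted Gabidulin code `H_{k,s}(η,h)` for `1 ≤ k`: the `Fq`-space of all
`Fq`-linear maps of `F` of the form
`x ↦ a₀ x + a₁ x^(q^s) + ⋯ + a_{k-1} x^(q^(s(k-1))) + a₀^(q^h) η x^(q^(sk))`.
Only the values `a 0, …, a (k - 1)` of the sequence `a` matter. -/
def twistedGabidulin (k : ℕ) (s : ℤ) (η : F) (h : ℤ) : Submodule Fq (Module.End Fq F) where
  carrier := {f | ∃ a : ℕ → F, ∀ x : F,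
    f x = ∑ i ∈ Finset.range k, a i * qFrob Fq F (s * i) x
      + qFrob Fq F h (a 0) * η * qFrob Fq F (s * k) x}
  zero_mem' := ⟨0, fun x => by simp⟩
  add_mem' := by
    rintro f g ⟨a, ha⟩ ⟨b, hb⟩
    refine ⟨a + b, fun x => ?_⟩
    simp only [LinearMap.add_apply, ha, hb, Pi.add_apply, add_mul, map_add,
      Finset.sum_add_distrib]
    ring
  smul_mem' := by
    rintro c f ⟨a, ha⟩
    refine ⟨c • a, fun x => ?_⟩
    simp only [LinearMap.smul_apply, ha, Pi.smul_apply, smul_add, Finset.smul_sum,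
      smul_mul_assoc, map_smul]

end TwistedGabidulin

section Idealisers

variable {K V : Type*} [Field K] [AddCommGroup V] [Module K V]

/-- The left idealiser `L(C) = {φ : φ ∘ f ∈ C for all f ∈ C}` of a linear code `C` of linear maps,
with its structure of a `K`-algebra under addition and composition. -/
def leftIdealiser (C : Submodule K (Module.End K V)) : Subalgebra K (Module.End K V) where
  carrier := {φ | ∀ f ∈ C, φ ∘ₗ f ∈ C}
  mul_mem' := fun {φ ψ} hφ hψ f hf => hφ (ψ ∘ₗ f) (hψ f hf)
  add_mem' := fun {φ ψ} hφ hψ f hf => by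
    rw [LinearMap.add_comp]
    exact C.add_mem (hφ f hf) (hψ f hf)
  algebraMap_mem' := fun c f hf => C.smul_mem c hf

/-- The right idealiser `R(C) = {φ : f ∘ φ ∈ C for all f ∈ C}` of a linear code `C` of linear maps,
with its structure of a `K`-algebra under addition and composition. -/
def rightIdealiser (C : Submodule K (Module.End K V)) : Subalgebra K (Module.End K V) where
  carrier := {φ | ∀ f ∈ C, f ∘ₗ φ ∈ C}
  mul_mem' := fun {φ ψ} hφ hψ f hf => hψ (f ∘ₗ φ) (hφ f hf)
  add_mem' := fun {φ ψ} hφ hψ f hf => by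
    rw [LinearMap.comp_add]
    exact C.add_mem (hφ f hf) (hψ f hf)
  algebraMap_mem' := fun c f hf => by
    have : f ∘ₗ (algebraMap K (Module.End K V) c) = c • f := by
      ext x
      simp
    rw [this]
    exact C.smul_mem c hf

end Idealisers

section GaloisExpansion

variable {K L : Type*} [Field K] [Field L] [Algebra K L]

/-- Two proportional automorphisms of a field are equal, or the factors vanish. -/
theorem AlgEquiv.eq_zero_of_forall_mul_eq_mul {g t : Gal(L/K)} (hgt : g ≠ t) {x y : L}
    (h : ∀ a, x * g a = y * t a) : x = 0 ∧ y = 0 := by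
  have hxy : x = y := by simpa using h 1
  subst hxy
  obtain ⟨a, ha⟩ := DFunLike.exists_ne hgt
  have : x = 0 := by
    by_contra hx
    exact ha (mul_left_cancel₀ hx (h a))
  exact ⟨this, this⟩

theorem lmul_eq_smul (a : L) :
    Algebra.lmul K L a = a • ((1 : Gal(L/K)).toLinearMap : Module.End K L) := by
  ext x
  simp

theorem linearIndependent_galois :
    LinearIndependent L (fun g : Gal(L/K) => (g.toLinearMap : Module.End K L)) :=
  (linearIndependent_toLinearMap K L L).comp (fun g : Gal(L/K) => (g : L →ₐ[K] L))
    fun _ _ h => AlgEquiv.ext fun x => DFunLike.congr_fun h x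

variable [FiniteDimensional K L] [IsGalois K L]

variable (K L) in
/-- The elements of the Galois group form a basis over `L` of the space of `K`-linear endomorphisms
of `L`. -/
noncomputable def galoisBasis : Module.Basis Gal(L/K) L (Module.End K L) :=
  basisOfLinearIndependentOfCardEqFinrank
    linearIndependent_galois
    (by
      rw [← Nat.card_eq_fintype_card, IsGalois.card_aut_eq_finrank]
      exact (Module.finrank_linearMap_self K L L).symm)

theorem galoisBasis_apply (g : Gal(L/K)) : galoisBasis K L g = g.toLinearMap := by
  simp [galoisBasis]

/-- The coefficient of `g` in the expansion of an endomorphism as an `L`-linear combination of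
elements of the Galois group. -/
noncomputable def galCoeff (f : Module.End K L) (g : Gal(L/K)) : L :=
  (galoisBasis K L).repr f g

theorem sum_galCoeff_smul (f : Module.End K L) :
    ∑ g : Gal(L/K), galCoeff f g • (g.toLinearMap : Module.End K L) = f := by
  have h := (galoisBasis K L).sum_repr f
  simp only [galoisBasis_apply] at h
  exact h

theorem galCoeff_ext {f f' : Module.End K L} (h : ∀ g, galCoeff f g = galCoeff f' g) : f = f' :=
  (galoisBasis K L).repr.injective (Finsupp.ext h)

theorem galCoeff_add (f f' : Module.End K L) (g : Gal(L/K)) :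
    galCoeff (f + f') g = galCoeff f g + galCoeff f' g := by
  simp [galCoeff]

theorem galCoeff_sum {ι : Type*} (S : Finset ι) (f : ι → Module.End K L) (g : Gal(L/K)) :
    galCoeff (∑ i ∈ S, f i) g = ∑ i ∈ S, galCoeff (f i) g := by
  simp [galCoeff]

open Classical in
theorem galCoeff_smul_toLinearMap (a : L) (t g : Gal(L/K)) :
    galCoeff (a • (t.toLinearMap : Module.End K L)) g = if t = g then a else 0 := by
  rw [galCoeff, ← galoisBasis_apply, map_smul, Module.Basis.repr_self, Finsupp.smul_single,
    Finsupp.single_apply]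
  simp

theorem galCoeff_comp_smul (φ : Module.End K L) (a : L) (t g : Gal(L/K)) :
    galCoeff (φ ∘ₗ (a • (t.toLinearMap : Module.End K L))) g
      = galCoeff φ (g * t⁻¹) * (g * t⁻¹) a := by
  classical
  have h : φ ∘ₗ (a • (t.toLinearMap : Module.End K L))
      = ∑ u : Gal(L/K), (galCoeff φ u * u a) • ((u * t : Gal(L/K)).toLinearMap : Module.End K L) := by
    conv_lhs => rw [← sum_galCoeff_smul φ]
    ext x
    simp [LinearMap.sum_apply, mul_assoc]
  rw [h, galCoeff_sum]
  simp only [galCoeff_smul_toLinearMap, ← eq_mul_inv_iff_mul_eq]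
  simp

theorem galCoeff_smul_comp (φ : Module.End K L) (a : L) (t g : Gal(L/K)) :
    galCoeff ((a • (t.toLinearMap : Module.End K L)) ∘ₗ φ) g
      = a * t (galCoeff φ (t⁻¹ * g)) := by
  classical
  have h : (a • (t.toLinearMap : Module.End K L)) ∘ₗ φ
      = ∑ u : Gal(L/K), (a * t (galCoeff φ u)) • ((t * u : Gal(L/K)).toLinearMap : Module.End K L) := by
    conv_lhs => rw [← sum_galCoeff_smul φ]
    ext x
    simp [LinearMap.sum_apply, mul_assoc, Finset.mul_sum]
  rw [h, galCoeff_sum]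
  simp only [galCoeff_smul_toLinearMap, ← eq_inv_mul_iff_mul_eq]
  simp

/-- An endomorphism with only the coefficient of the identity is a multiplication. -/
theorem eq_lmul_of_galCoeff_eq_zero {φ : Module.End K L} (h : ∀ g, g ≠ 1 → galCoeff φ g = 0) :
    φ = Algebra.lmul K L (galCoeff φ 1) := by
  conv_lhs => rw [← sum_galCoeff_smul φ]
  rw [Finset.sum_eq_single 1 (fun g _ hg => by rw [h g hg, zero_smul]) (by simp)]
  ext x
  simp

end GaloisExpansion

section TraceAdjoint

variable {K L : Type*} [Field K] [Field L] [Algebra K L] [FiniteDimensional K L] [IsGalois K L]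

theorem eq_of_forall_trace_mul_eq {u v : L}
    (h : ∀ y, Algebra.trace K L (u * y) = Algebra.trace K L (v * y)) : u = v := by
  refine sub_eq_zero.mp ((traceForm_nondegenerate K L).1 (u - v) fun y => ?_)
  rw [Algebra.traceForm_apply, sub_mul, map_sub, h, sub_self]

/-- Existence of adjoints with respect to the trace form. -/
theorem exists_trace_adjoint (f : Module.End K L) :
    ∃ f' : Module.End K L, ∀ x y,
      Algebra.trace K L (f' x * y) = Algebra.trace K L (x * f y) :=
  ⟨_, LinearMap.BilinForm.isAdjointPairLeftAdjointOfNondegenerate _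
    (traceForm_nondegenerate K L) f⟩

/-- The adjoint of an endomorphism with respect to the trace form. -/
noncomputable def traceAdjointFun (f : Module.End K L) : Module.End K L :=
  (exists_trace_adjoint f).choose

theorem trace_traceAdjointFun_mul (f : Module.End K L) (x y : L) :
    Algebra.trace K L (traceAdjointFun f x * y) = Algebra.trace K L (x * f y) :=
  (exists_trace_adjoint f).choose_spec x y

theorem traceAdjointFun_eq {f f' : Module.End K L}
    (h : ∀ x y, Algebra.trace K L (f' x * y) = Algebra.trace K L (x * f y)) :
    traceAdjointFun f = f' :=
  LinearMap.ext fun x => eq_of_forall_trace_mul_eq fun y => by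
    rw [trace_traceAdjointFun_mul, h]

variable (K L) in
/-- Passing to the adjoint with respect to the trace form, as a linear involution. -/
noncomputable def traceAdjoint : Module.End K L ≃ₗ[K] Module.End K L :=
  LinearEquiv.ofInvolutive
    { toFun := traceAdjointFun
      map_add' := fun f g => traceAdjointFun_eq fun x y => by
        simp [add_mul, mul_add, trace_traceAdjointFun_mul]
      map_smul' := fun c f => traceAdjointFun_eq fun x y => by
        simp [trace_traceAdjointFun_mul] }
    fun f => traceAdjointFun_eq fun x y => by
      change _ = Algebra.trace K L (x * traceAdjointFun f y)
      rw [mul_comm x, trace_traceAdjointFun_mul, mul_comm]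

theorem trace_traceAdjoint_mul (f : Module.End K L) (x y : L) :
    Algebra.trace K L (traceAdjoint K L f x * y) = Algebra.trace K L (x * f y) :=
  trace_traceAdjointFun_mul f x y

theorem traceAdjoint_eq {f f' : Module.End K L}
    (h : ∀ x y, Algebra.trace K L (f' x * y) = Algebra.trace K L (x * f y)) :
    traceAdjoint K L f = f' :=
  traceAdjointFun_eq h

theorem traceAdjoint_comp (f g : Module.End K L) :
    traceAdjoint K L (f ∘ₗ g) = traceAdjoint K L g ∘ₗ traceAdjoint K L f :=
  traceAdjoint_eq fun x y => by
    simp [trace_traceAdjoint_mul]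

theorem traceAdjoint_one : traceAdjoint K L 1 = 1 :=
  traceAdjoint_eq fun x y => by simp

theorem traceAdjoint_smul_toLinearMap (a : L) (g : Gal(L/K)) :
    traceAdjoint K L (a • g.toLinearMap) = g⁻¹ a • (g⁻¹).toLinearMap :=
  traceAdjoint_eq fun x y => by
    rw [← Algebra.trace_eq_of_algEquiv g]
    congr 1
    simp only [LinearMap.smul_apply, AlgEquiv.toLinearMap_apply, smul_eq_mul, map_mul,
      ← AlgEquiv.mul_apply, mul_inv_cancel, AlgEquiv.one_apply]
    ring

theorem galCoeff_traceAdjoint (f : Module.End K L) (g : Gal(L/K)) :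
    galCoeff (traceAdjoint K L f) g = g (galCoeff f g⁻¹) := by
  classical
  conv_lhs => rw [← sum_galCoeff_smul f]
  rw [map_sum, galCoeff_sum]
  simp only [traceAdjoint_smul_toLinearMap, galCoeff_smul_toLinearMap, inv_eq_iff_eq_inv]
  rw [Finset.sum_ite_eq' Finset.univ g⁻¹, if_pos (Finset.mem_univ _), inv_inv]

end TraceAdjoint

section Idealisers

variable {K V : Type*} [Field K] [AddCommGroup V] [Module K V]

/-- If an anti-automorphism of the endomorphism algebra maps one subalgebra onto another one, which
is isomorphic to a commutative algebra, then both are isomorphic to that algebra. -/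
theorem nonempty_algEquiv_of_antiAutomorphism {R S : Subalgebra K (Module.End K V)}
    (θ : Module.End K V ≃ₗ[K] Module.End K V) (hone : θ 1 = 1)
    (hmul : ∀ f g, θ (f * g) = θ g * θ f) (hRS : ∀ φ, φ ∈ R ↔ θ φ ∈ S)
    {A : Type*} [CommRing A] [Algebra K A] (e : Nonempty (S ≃ₐ[K] A)) :
    Nonempty (R ≃ₐ[K] A) := by
  obtain ⟨e⟩ := e
  let t : R →ₗ[K] S :=
    { toFun := fun φ => ⟨θ φ, (hRS φ).1 φ.2⟩
      map_add' := fun φ ψ => Subtype.ext (by simp)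
      map_smul' := fun c φ => Subtype.ext (by simp) }
  have ht : Function.Bijective t := by
    refine ⟨fun φ ψ h => Subtype.ext (θ.injective (Subtype.ext_iff.1 h)), fun ψ => ?_⟩
    refine ⟨⟨θ.symm ψ, (hRS _).2 (by simp)⟩, Subtype.ext ?_⟩
    simp [t]
  refine ⟨AlgEquiv.ofLinearEquiv ((LinearEquiv.ofBijective t ht).trans e.toLinearEquiv) ?_ ?_⟩
  · have : t 1 = 1 := Subtype.ext hone
    simp [this]
  · intro φ ψ
    have : t (φ * ψ) = t ψ * t φ := Subtype.ext (hmul φ ψ)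
    change e (t (φ * ψ)) = e (t φ) * e (t ψ)
    rw [this, map_mul, mul_comm]

/-- Composing a code with an invertible map on the left conjugates the left idealiser. -/
theorem nonempty_leftIdealiser_algEquiv_of_comp {C D : Submodule K (Module.End K V)}
    (g : V ≃ₗ[K] V) (hCD : ∀ f, f ∈ C ↔ g.toLinearMap ∘ₗ f ∈ D) :
    Nonempty (leftIdealiser C ≃ₐ[K] leftIdealiser D) := by
  have h : (leftIdealiser C).map (g.conjAlgEquiv K : Module.End K V →ₐ[K] Module.End K V)
      = leftIdealiser D := by
    ext φ
    constructor
    · rintro ⟨ψ, hψ, rfl⟩ f hf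
      have := (hCD _).1 (hψ (g.symm.toLinearMap ∘ₗ f) ((hCD _).2 (by
        convert hf using 1
        ext x
        simp)))
      convert this using 1
      rfl
    · intro hφ
      refine ⟨(g.conjAlgEquiv K).symm φ, fun f hf => ?_, (g.conjAlgEquiv K).apply_symm_apply φ⟩
      rw [hCD] at hf ⊢
      convert hφ _ hf using 1
      ext x
      simp [LinearEquiv.symm_conjAlgEquiv, LinearEquiv.conjAlgEquiv_apply]
  exact ⟨((g.conjAlgEquiv K).subalgebraMap _).trans (Subalgebra.equivOfEq _ _ h)⟩

end Idealisers

section TwistedCode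

variable {K L : Type*} [Field K] [Field L] [Algebra K L]

theorem zpow_eq_zpow_iff_dvd {σ : Gal(L/K)} {n : ℕ} (hσ : orderOf σ = n) {i j : ℤ} :
    σ ^ i = σ ^ j ↔ (n : ℤ) ∣ i - j := by
  rw [← hσ, orderOf_dvd_iff_zpow_eq_one, zpow_sub, mul_inv_eq_one]

theorem eq_of_zpow_eq_zpow {σ : Gal(L/K)} {n : ℕ} (hσ : orderOf σ = n) {i j : ℤ}
    (hi : 0 ≤ i) (hin : i < n) (hj : 0 ≤ j) (hjn : j < n) (h : σ ^ i = σ ^ j) : i = j := by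
  obtain ⟨c, hc⟩ := (zpow_eq_zpow_iff_dvd hσ).1 h
  have hn : (0 : ℤ) < n := by omega
  have h1 : c < 1 := by
    by_contra! hc'
    nlinarith
  have h2 : -1 < c := by
    by_contra! hc'
    nlinarith
  have h3 : c = 0 := by omega
  subst h3
  omega

variable [FiniteDimensional K L] [IsGalois K L]

theorem bijective_pow_of_orderOf_eq {σ : Gal(L/K)} {n : ℕ} (hσ : orderOf σ = n)
    (hn : Module.finrank K L = n) :
    Function.Bijective fun i : Fin n => σ ^ (i : ℕ) := by
  rw [Fintype.bijective_iff_injective_and_card]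
  constructor
  · intro i j h
    exact Fin.ext (pow_injOn_Iio_orderOf (by simp [hσ]) (by simp [hσ]) h)
  · rw [Fintype.card_fin, ← hn, ← IsGalois.card_aut_eq_finrank, Nat.card_eq_fintype_card]

theorem exists_zpow_eq {σ : Gal(L/K)} {n : ℕ} (hσ : orderOf σ = n)
    (hn : Module.finrank K L = n) (g : Gal(L/K)) : ∃ j : ℤ, 0 ≤ j ∧ j < n ∧ σ ^ j = g := by
  obtain ⟨i, hi⟩ := (bijective_pow_of_orderOf_eq hσ hn).2 g
  exact ⟨(i : ℕ), by omega, by omega, by simpa using hi⟩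

theorem algebraMap_norm_eq_prod_pow {σ : Gal(L/K)} {n : ℕ} (hσ : orderOf σ = n)
    (hn : Module.finrank K L = n) (x : L) :
    algebraMap K L (Algebra.norm K x) = ∏ i ∈ Finset.range n, (σ ^ i) x := by
  rw [Algebra.norm_eq_prod_automorphisms, Finset.prod_range]
  exact ((bijective_pow_of_orderOf_eq hσ hn).prod_comp fun g => g x).symm

/-- The code of all endomorphisms `a₀ + a₁ σ + ⋯ + a_{k-1} σ^(k-1) + η τ(a₀) σ^k`, described by the
coefficients of its elements. Here `σ` is meant to generate the Galois group, which has order `n`. -/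
def IsTwistedCode (C : Submodule K (Module.End K L)) (σ τ : Gal(L/K)) (n k : ℕ) (η : L) : Prop :=
  ∀ f, f ∈ C ↔ (∀ j : ℤ, k < j → j < n → galCoeff f (σ ^ j) = 0) ∧
    galCoeff f (σ ^ (k : ℤ)) = η * τ (galCoeff f 1)

namespace IsTwistedCode

variable {C : Submodule K (Module.End K L)} {σ τ : Gal(L/K)} {n k : ℕ} {η : L}

theorem smul_zpow_mem (hC : IsTwistedCode C σ τ n k η) (hσ : orderOf σ = n) (hkn : k + 1 ≤ n)
    (a : L) {i : ℤ} (hi : 1 ≤ i) (hik : i < k) : a • ((σ ^ i).toLinearMap : Module.End K L) ∈ C := by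
  classical
  rw [hC]
  have h : ∀ j : ℤ, 0 ≤ j → j < n → j ≠ i →
      galCoeff (a • ((σ ^ i).toLinearMap : Module.End K L)) (σ ^ j) = 0 := by
    intro j hj hjn hji
    rw [galCoeff_smul_toLinearMap, if_neg]
    intro h
    exact hji (eq_of_zpow_eq_zpow hσ (by omega) (by omega) hj hjn h).symm
  refine ⟨fun j hj hjn => h j (by omega) hjn (by omega), ?_⟩
  have h0 := h 0 le_rfl (by omega) (by omega)
  rw [zpow_zero] at h0
  rw [h k (by omega) (by omega) (by omega), h0, map_zero, mul_zero]

theorem smul_one_add_mem (hC : IsTwistedCode C σ τ n k η) (hσ : orderOf σ = n) (hk : 1 ≤ k)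
    (hkn : k + 1 ≤ n) (a : L) :
    a • ((1 : Gal(L/K)).toLinearMap : Module.End K L)
      + (η * τ a) • ((σ ^ (k : ℤ)).toLinearMap : Module.End K L) ∈ C := by
  classical
  rw [hC]
  have h1 : ∀ j : ℤ, 0 < j → j < n → (1 : Gal(L/K)) ≠ σ ^ j := by
    intro j hj hjn h
    rw [← zpow_zero σ] at h
    exact hj.ne (eq_of_zpow_eq_zpow hσ le_rfl (by omega) hj.le hjn h)
  refine ⟨fun j hj hjn => ?_, ?_⟩
  · rw [galCoeff_add, galCoeff_smul_toLinearMap, galCoeff_smul_toLinearMap,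
      if_neg (h1 j (by omega) hjn), if_neg, add_zero]
    intro h
    exact hj.ne (eq_of_zpow_eq_zpow hσ (by omega) (by omega) (by omega) hjn h)
  · have := h1 k (by omega) (by omega)
    simp only [galCoeff_add, galCoeff_smul_toLinearMap, if_neg this, if_neg this.symm, if_true,
      zero_add, add_zero]

variable {φ : Module.End K L}

theorem galCoeff_eq_zero_of_mem (hC : IsTwistedCode C σ τ n k η) (hσ : orderOf σ = n)
    (hkn : k + 1 ≤ n) (hφ : φ ∈ leftIdealiser C) {m i : ℤ} (hi : 1 ≤ i) (hik : i < k)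
    (hm : k < m + i) (hmn : m + i < n) : galCoeff φ (σ ^ m) = 0 := by
  have h := ((hC _).1 (hφ _ (hC.smul_zpow_mem hσ hkn 1 hi hik))).1 (m + i) hm hmn
  rw [galCoeff_comp_smul, ← zpow_neg, ← zpow_add, map_one, mul_one] at h
  simpa using h

theorem galCoeff_sub_mul_eq_of_mem (hC : IsTwistedCode C σ τ n k η) (hσ : orderOf σ = n)
    (hkn : k + 1 ≤ n) (hφ : φ ∈ leftIdealiser C) {i : ℤ} (hi : 1 ≤ i) (hik : i < k) (a : L) :
    galCoeff φ (σ ^ (k - i)) * (σ ^ (k - i)) a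
      = η * τ (galCoeff φ (σ ^ (-i)) * (σ ^ (-i)) a) := by
  have h := ((hC _).1 (hφ _ (hC.smul_zpow_mem hσ hkn a hi hik))).2
  rwa [galCoeff_comp_smul, galCoeff_comp_smul, ← zpow_neg, ← zpow_add, one_mul,
    ← sub_eq_add_neg] at h

theorem galCoeff_add_eq_zero_of_mem (hC : IsTwistedCode C σ τ n k η) (hσ : orderOf σ = n)
    (hk : 1 ≤ k) (hkn : k + 1 ≤ n) (hφ : φ ∈ leftIdealiser C) {j : ℤ} (hj : k < j) (hjn : j < n)
    (a : L) : galCoeff φ (σ ^ j) * (σ ^ j) a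
      + galCoeff φ (σ ^ (j - k)) * (σ ^ (j - k)) (η * τ a) = 0 := by
  have h := ((hC _).1 (hφ _ (hC.smul_one_add_mem hσ hk hkn a))).1 j hj hjn
  rwa [LinearMap.comp_add, galCoeff_add, galCoeff_comp_smul, galCoeff_comp_smul, ← zpow_neg,
    ← zpow_add, inv_one, mul_one, ← sub_eq_add_neg] at h

theorem galCoeff_add_eq_of_mem (hC : IsTwistedCode C σ τ n k η) (hσ : orderOf σ = n)
    (hk : 1 ≤ k) (hkn : k + 1 ≤ n) (hφ : φ ∈ leftIdealiser C) (a : L) :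
    galCoeff φ (σ ^ (k : ℤ)) * (σ ^ (k : ℤ)) a + galCoeff φ 1 * (η * τ a)
      = η * τ (galCoeff φ 1 * a
        + galCoeff φ (σ ^ (-k : ℤ)) * (σ ^ (-k : ℤ)) (η * τ a)) := by
  have h := ((hC _).1 (hφ _ (hC.smul_one_add_mem hσ hk hkn a))).2
  rwa [LinearMap.comp_add, galCoeff_add, galCoeff_add, galCoeff_comp_smul, galCoeff_comp_smul,
    galCoeff_comp_smul, galCoeff_comp_smul, ← zpow_neg, ← zpow_add, inv_one, mul_one, mul_one,
    one_mul, add_neg_cancel, zpow_zero, AlgEquiv.one_apply, AlgEquiv.one_apply] at h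

theorem galCoeff_zpow_sub (hσ : orderOf σ = n) (m : ℤ) :
    galCoeff φ (σ ^ (m - n)) = galCoeff φ (σ ^ m) := by
  rw [(zpow_eq_zpow_iff_dvd hσ).2]
  exact ⟨-1, by ring⟩

/-- The idealiser condition in the case `k = 1`. -/
theorem galCoeff_eq_zero_of_eq_one (hC : IsTwistedCode C σ τ n 1 η) (hσ : orderOf σ = n)
    (hn : Module.finrank K L = n) (hkn : 2 ≤ n) (hη : η ≠ 0)
    (hnorm : Algebra.norm K η ≠ (-1) ^ n) (hτ : τ ≠ σ)
    (hφ : φ ∈ leftIdealiser C) {m : ℤ} (hm : 0 < m) (hmn : m < n) : galCoeff φ (σ ^ m) = 0 := by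
  rcases hkn.eq_or_lt with rfl | hkn'
  · have hm1 : m = 1 := by
      push_cast at hmn
      omega
    subst hm1
    have hτ1 : τ = 1 := by
      obtain ⟨j, hj, hjn, rfl⟩ := exists_zpow_eq hσ hn τ
      have : j ≠ 1 := by
        rintro rfl
        simp at hτ
      have : j = 0 := by
        push_cast at hjn
        omega
      simp [this]
    subst hτ1
    have h := hC.galCoeff_add_eq_of_mem hσ le_rfl le_rfl hφ 1
    have hinv : σ ^ (-1 : ℤ) = σ := by
      conv_rhs => rw [← zpow_one σ]
      exact (zpow_eq_zpow_iff_dvd hσ).2 ⟨-1, by norm_num⟩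
    by_contra hne
    apply hnorm
    apply (algebraMap K L).injective
    rw [algebraMap_norm_eq_prod_pow hσ hn]
    simp only [Nat.cast_one, zpow_one, hinv, map_one, mul_one, AlgEquiv.one_apply] at h hne
    simp only [Finset.prod_range_succ, Finset.prod_range_zero, pow_zero, pow_one,
      AlgEquiv.one_apply, one_mul]
    apply mul_left_cancel₀ hne
    simp
    linear_combination -h
  · have hne : ∀ j : ℤ, σ ^ j ≠ σ ^ (j - 1) * τ := by
      intro j h
      rw [← sub_add_cancel j 1, zpow_add, add_sub_cancel_right, zpow_one] at h
      exact hτ (mul_left_cancel h).symm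
    have key : ∀ j : ℤ, 1 < j → j < n →
        galCoeff φ (σ ^ j) = 0 ∧ galCoeff φ (σ ^ (j - 1)) = 0 := by
      intro j hj hjn
      have h := AlgEquiv.eq_zero_of_forall_mul_eq_mul (hne j) (x := galCoeff φ (σ ^ j))
        (y := -(galCoeff φ (σ ^ (j - 1)) * (σ ^ (j - 1)) η)) fun a => by
          have h := hC.galCoeff_add_eq_zero_of_mem hσ le_rfl (by omega) hφ (j := j)
            (by simpa using hj) hjn a
          simp only [Nat.cast_one, map_mul] at h
          rw [AlgEquiv.mul_apply]
          linear_combination h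
      simpa [hη] using h
    rcases (show 1 ≤ m by omega).eq_or_lt with rfl | hm1
    · simpa using (key 2 (by omega) (by omega)).2
    · exact (key m hm1 hmn).1

/-- The idealiser condition in the case `k = n - 1`. -/
theorem galCoeff_eq_zero_of_add_one_eq (hC : IsTwistedCode C σ τ n k η) (hσ : orderOf σ = n)
    (hk : 2 ≤ k) (hkn : k + 1 = n) (hη : η ≠ 0) (hτ : τ ≠ σ ^ (k : ℤ))
    (hφ : φ ∈ leftIdealiser C) {m : ℤ} (hm : 0 < m) (hmn : m < n) : galCoeff φ (σ ^ m) = 0 := by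
  have key : ∀ i : ℤ, 1 ≤ i → i < k →
      galCoeff φ (σ ^ (k - i)) = 0 ∧ galCoeff φ (σ ^ (-i)) = 0 := by
    intro i hi hik
    have hne : σ ^ (k - i) ≠ τ * σ ^ (-i) := by
      rw [sub_eq_add_neg, zpow_add]
      exact fun h => hτ (mul_right_cancel h).symm
    have h := AlgEquiv.eq_zero_of_forall_mul_eq_mul hne (x := galCoeff φ (σ ^ (k - i)))
      (y := η * τ (galCoeff φ (σ ^ (-i)))) fun a => by
        have h := hC.galCoeff_sub_mul_eq_of_mem hσ hkn.le hφ hi hik a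
        rw [map_mul] at h
        rw [AlgEquiv.mul_apply]
        linear_combination h
    simpa [hη] using h
  rcases (show m ≤ k by omega).eq_or_lt with rfl | hmk
  · have h := (key 1 le_rfl (by omega)).2
    rw [← galCoeff_zpow_sub hσ, ← hkn]
    simpa using h
  · have h := (key (k - m) (by omega) (by omega)).1
    rwa [sub_sub_cancel] at h

/-- The idealiser condition in the case `2 ≤ k ≤ n - 2`. -/
theorem galCoeff_eq_zero_of_two_le (hC : IsTwistedCode C σ τ n k η) (hσ : orderOf σ = n)
    (hn : Module.finrank K L = n) (hk : 2 ≤ k) (hkn : k + 2 ≤ n) (hη : η ≠ 0)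
    (hnorm : Algebra.norm K η ≠ (-1) ^ (n * k))
    (hφ : φ ∈ leftIdealiser C) {m : ℤ} (hm : 0 < m) (hmn : m < n) : galCoeff φ (σ ^ m) = 0 := by
  have mid : ∀ j : ℤ, 2 ≤ j → j + 2 ≤ n → galCoeff φ (σ ^ j) = 0 := by
    intro j hj hjn
    rcases le_or_gt (k : ℤ) j with hkj | hkj
    · exact hC.galCoeff_eq_zero_of_mem hσ (by omega) hφ (i := 1) le_rfl (by omega) (by omega)
        (by omega)
    · exact hC.galCoeff_eq_zero_of_mem hσ (by omega) hφ (i := k + 1 - j) (by omega) (by omega)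
        (by omega) (by omega)
  have ends : galCoeff φ (σ ^ (1 : ℤ)) = 0 ∧ galCoeff φ (σ ^ (-1 : ℤ)) = 0 := by
    rcases hk.eq_or_lt with rfl | hk3
    · rcases hkn.eq_or_lt with rfl | hn5
      · have h1 := hC.galCoeff_sub_mul_eq_of_mem hσ (by norm_num) hφ (i := 1) le_rfl (by norm_num)
        have h2 := hC.galCoeff_add_eq_zero_of_mem hσ (by norm_num) (by norm_num) hφ (j := 3)
          (by norm_num) (by norm_num)
        have h3 : σ ^ (3 : ℤ) = σ ^ (-1 : ℤ) := (zpow_eq_zpow_iff_dvd hσ).2 (by norm_num)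
        rw [← h3] at h1 ⊢
        norm_num at h1 h2 ⊢
        by_cases hτ : σ ^ 3 = σ * τ
        · replace hτ : τ = σ ^ 2 := by
            apply mul_left_cancel (a := σ)
            rw [← hτ, ← pow_succ']
          replace h1 := h1 1
          replace h2 := h2 1
          have h0 : galCoeff φ σ = 0 := by
            by_contra hne
            apply hnorm
            apply (algebraMap K L).injective
            rw [algebraMap_norm_eq_prod_pow hσ hn]
            simp only [Finset.prod_range_succ, Finset.prod_range_zero]
            apply mul_left_cancel₀ hne
            have h4 : ∀ x, σ (σ (σ (σ x))) = x := fun x => by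
              have h := DFunLike.congr_fun (pow_orderOf_eq_one σ) x
              rw [hσ] at h
              exact h
            rw [hτ] at h1 h2
            simp only [pow_succ, pow_zero, one_mul, AlgEquiv.mul_apply, map_one, mul_one] at h1 h2 ⊢
            rw [eq_neg_of_add_eq_zero_left h2] at h1
            simp only [map_neg, map_mul] at h1
            have h5 := congrArg (fun x => σ (σ x)) h1
            simp only [map_neg, map_mul, h4] at h5
            rw [h5] at h1
            simp
            linear_combination -h1
          simp [h0] at h2 ⊢
          exact h2
        · have h := AlgEquiv.eq_zero_of_forall_mul_eq_mul hτ (x := galCoeff φ (σ ^ 3))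
            (y := -(galCoeff φ σ * σ η)) fun a => by
              have h5 : (σ ^ 3) a = σ (σ (σ a)) := rfl
              rw [AlgEquiv.mul_apply, h5]
              linear_combination h2 a
          exact ⟨by simpa [hη] using h.2, h.1⟩
      · have h1 := hC.galCoeff_add_eq_zero_of_mem hσ (by norm_num) (by omega) hφ (j := n - 1)
          (by push_cast; omega) (by omega) 1
        have h2 := hC.galCoeff_add_eq_zero_of_mem hσ (by norm_num) (by omega) hφ (j := 3)
          (by norm_num) (by omega) 1
        rw [mid 3 (by omega) (by omega)] at h2
        rw [mid (n - 1 - (2 : ℕ)) (by push_cast; omega) (by push_cast; omega)] at h1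
        norm_num [hη] at h1 h2
        refine ⟨by simpa using h2, ?_⟩
        rwa [← galCoeff_zpow_sub hσ, sub_sub_cancel_left] at h1
    · have h1 := hC.galCoeff_sub_mul_eq_of_mem hσ (by omega) hφ (i := k - 1) (by omega) (by omega) 1
      have h2 := hC.galCoeff_sub_mul_eq_of_mem hσ (by omega) hφ (i := 1) (by omega) (by omega) 1
      rw [mid (k - 1) (by omega) (by omega)] at h2
      have h3 := mid (1 - k + n) (by omega) (by omega)
      rw [← galCoeff_zpow_sub hσ, add_sub_cancel_right] at h3
      rw [neg_sub, h3, sub_sub_cancel] at h1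
      constructor
      · simpa using h1
      · simpa [hη] using h2.symm
  rcases (show 1 ≤ m by omega).eq_or_lt with rfl | hm1
  · exact ends.1
  rcases (show m ≤ n - 1 by omega).eq_or_lt with rfl | hmn1
  · rw [← galCoeff_zpow_sub hσ, sub_sub_cancel_left]
    exact ends.2
  · exact mid m (by omega) (by omega)

end IsTwistedCode

end TwistedCode

section TwistedCode

variable {K L : Type*} [Field K] [Field L] [Algebra K L]

theorem mem_fixedField_zpowers_iff (τ : Gal(L/K)) (x : L) :
    x ∈ IntermediateField.fixedField (Subgroup.zpowers τ) ↔ τ x = x := by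
  rw [IntermediateField.mem_fixedField_iff]
  refine ⟨fun h => h τ (Subgroup.mem_zpowers τ), fun h f hf => ?_⟩
  have : Subgroup.zpowers τ ≤ MulAction.stabilizer Gal(L/K) x := by
    rw [Subgroup.zpowers_le]
    exact h
  exact this hf

theorem leftIdealiser_range_lmul :
    leftIdealiser (LinearMap.range (Algebra.lmul K L).toLinearMap) = (Algebra.lmul K L).range := by
  ext φ
  constructor
  · intro h
    obtain ⟨a, ha⟩ := h 1 ⟨1, map_one (Algebra.lmul K L)⟩
    exact ⟨a, ha⟩
  · rintro ⟨a, rfl⟩ _ ⟨b, rfl⟩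
    exact ⟨a * b, map_mul (Algebra.lmul K L) a b⟩

variable (K L) in
theorem nonempty_range_lmul_algEquiv : Nonempty ((Algebra.lmul K L).range ≃ₐ[K] L) :=
  ⟨(AlgEquiv.ofInjective _ Algebra.lmul_injective).symm⟩

theorem norm_inv_eq_inv_norm {x : L} (hx : x ≠ 0) :
    Algebra.norm K x⁻¹ = (Algebra.norm K x)⁻¹ := by
  apply eq_inv_of_mul_eq_one_left
  rw [← map_mul, inv_mul_cancel₀ hx, map_one]

variable [FiniteDimensional K L] [IsGalois K L]

/-- The endomorphisms whose coefficient of the identity vanishes. -/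
def galCoeffOneKer (K L : Type*) [Field K] [Field L] [Algebra K L] [FiniteDimensional K L]
    [IsGalois K L] : Submodule K (Module.End K L) where
  carrier := {f | galCoeff f 1 = 0}
  zero_mem' := by simp [galCoeff]
  add_mem' := fun {f g} hf hg => by
    simp only [Set.mem_ofPred_eq] at hf hg ⊢
    rw [galCoeff_add, hf, hg, add_zero]
  smul_mem' := fun c f hf => by
    have h : c • f = (algebraMap K L c • ((1 : Gal(L/K)).toLinearMap : Module.End K L)) ∘ₗ f := by
      ext x
      simp [Algebra.smul_def]
    simp only [Set.mem_ofPred_eq] at hf ⊢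
    rw [h, galCoeff_smul_comp, inv_one, one_mul, hf, map_zero, mul_zero]

theorem mem_galCoeffOneKer {f : Module.End K L} : f ∈ galCoeffOneKer K L ↔ galCoeff f 1 = 0 :=
  Iff.rfl

theorem leftIdealiser_galCoeffOneKer :
    leftIdealiser (galCoeffOneKer K L) = (Algebra.lmul K L).range := by
  classical
  ext φ
  constructor
  · intro h
    refine ⟨galCoeff φ 1, (eq_lmul_of_galCoeff_eq_zero fun g hg => ?_).symm⟩
    have h1 := h ((1 : L) • ((g⁻¹ : Gal(L/K)).toLinearMap : Module.End K L)) (by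
      rw [mem_galCoeffOneKer, galCoeff_smul_toLinearMap, if_neg (by simpa using hg)])
    rw [mem_galCoeffOneKer, galCoeff_comp_smul] at h1
    simpa using h1
  · rintro ⟨a, rfl⟩ f hf
    rw [mem_galCoeffOneKer] at hf ⊢
    change galCoeff (Algebra.lmul K L a ∘ₗ f) 1 = 0
    rw [lmul_eq_smul, galCoeff_smul_comp, inv_one, one_mul, hf, map_zero, mul_zero]

/-- The map `x ↦ x - c g(x)` is invertible if `c` does not have norm `1`. -/
theorem exists_linearEquiv_sub_smul {c : L} (hc : Algebra.norm K c ≠ 1) (g : Gal(L/K)) :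
    ∃ e : L ≃ₗ[K] L, e.toLinearMap = (1 : L) • ((1 : Gal(L/K)).toLinearMap : Module.End K L)
      + (-c) • (g.toLinearMap : Module.End K L) := by
  have hinj : Function.Injective ((1 : L) • ((1 : Gal(L/K)).toLinearMap : Module.End K L)
      + (-c) • (g.toLinearMap : Module.End K L)) := by
    rw [injective_iff_map_eq_zero]
    intro x hx
    by_contra hne
    apply hc
    have h : x = c * g x := by
      simp at hx
      linear_combination hx
    have h2 := congrArg (Algebra.norm K) h
    rw [map_mul, Algebra.norm_eq_of_algEquiv] at h2
    exact mul_right_cancel₀ (Algebra.norm_ne_zero_iff.2 hne) (by rw [one_mul]; exact h2.symm)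
  exact ⟨LinearEquiv.ofInjectiveEndo _ hinj, rfl⟩

namespace IsTwistedCode

variable {C C' : Submodule K (Module.End K L)} {σ τ : Gal(L/K)} {n k : ℕ} {η : L}
  {φ : Module.End K L}

theorem lmul_mem_leftIdealiser (hC : IsTwistedCode C σ τ n k η) {a : L} (ha : τ a = a) :
    Algebra.lmul K L a ∈ leftIdealiser C := by
  intro f hf
  have h : ∀ g, galCoeff (Algebra.lmul K L a ∘ₗ f) g = a * galCoeff f g := fun g => by
    rw [lmul_eq_smul, galCoeff_smul_comp, inv_one, one_mul, AlgEquiv.one_apply]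
  rw [hC] at hf ⊢
  simp only [h]
  refine ⟨fun j hj hjn => by rw [hf.1 j hj hjn, mul_zero], ?_⟩
  rw [hf.2, map_mul, ha]
  ring

theorem mem_leftIdealiser_iff (hC : IsTwistedCode C σ τ n k η) (hσ : orderOf σ = n)
    (hn : Module.finrank K L = n) (hk : 1 ≤ k) (hkn : k + 1 ≤ n) (hη : η ≠ 0)
    (hnorm : Algebra.norm K η ≠ (-1) ^ (n * k))
    (hτ : ¬ ((k = 1 ∨ k + 1 = n) ∧ τ = σ ^ (k : ℤ))) :
    φ ∈ leftIdealiser C ↔ ∃ a, τ a = a ∧ Algebra.lmul K L a = φ := by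
  refine ⟨fun hφ => ?_, ?_⟩
  · have hzero : ∀ m : ℤ, 0 < m → m < n → galCoeff φ (σ ^ m) = 0 := by
      intro m hm hmn
      rcases hk.eq_or_lt with rfl | hk2
      · exact hC.galCoeff_eq_zero_of_eq_one hσ hn hkn hη (by simpa using hnorm)
          (fun h => hτ ⟨Or.inl rfl, by simpa using h⟩) hφ hm hmn
      rcases hkn.eq_or_lt with hkn' | hkn2
      · exact hC.galCoeff_eq_zero_of_add_one_eq hσ hk2 hkn' hη (fun h => hτ ⟨Or.inr hkn', h⟩) hφ
          hm hmn
      · exact hC.galCoeff_eq_zero_of_two_le hσ hn hk2 hkn2 hη hnorm hφ hm hmn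
    refine ⟨galCoeff φ 1, ?_, (eq_lmul_of_galCoeff_eq_zero fun g hg => ?_).symm⟩
    · have h := hC.galCoeff_add_eq_of_mem hσ hk hkn hφ 1
      have hneg := hzero (-k + n) (by omega) (by omega)
      rw [← galCoeff_zpow_sub hσ, add_sub_cancel_right] at hneg
      rw [hzero k (by omega) (by omega), hneg] at h
      apply mul_left_cancel₀ hη
      simp only [map_one, mul_one, zero_mul, zero_add, add_zero] at h
      linear_combination -h
    · obtain ⟨j, hj, hjn, rfl⟩ := exists_zpow_eq hσ hn g
      refine hzero j (lt_of_le_of_ne hj ?_) hjn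
      rintro rfl
      simp at hg
  · rintro ⟨a, ha, rfl⟩
    exact hC.lmul_mem_leftIdealiser ha

theorem nonempty_leftIdealiser_algEquiv_fixedField (hC : IsTwistedCode C σ τ n k η)
    (hσ : orderOf σ = n) (hn : Module.finrank K L = n) (hk : 1 ≤ k) (hkn : k + 1 ≤ n) (hη : η ≠ 0)
    (hnorm : Algebra.norm K η ≠ (-1) ^ (n * k))
    (hτ : ¬ ((k = 1 ∨ k + 1 = n) ∧ τ = σ ^ (k : ℤ))) :
    Nonempty (leftIdealiser C ≃ₐ[K] IntermediateField.fixedField (Subgroup.zpowers τ)) := by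
  let ι : IntermediateField.fixedField (Subgroup.zpowers τ) →ₐ[K] Module.End K L :=
    (Algebra.lmul K L).comp (IntermediateField.fixedField (Subgroup.zpowers τ)).val
  have hι : Function.Injective ι :=
    Algebra.lmul_injective.comp Subtype.val_injective
  have hrange : ι.range = leftIdealiser C := by
    ext φ
    rw [hC.mem_leftIdealiser_iff hσ hn hk hkn hη hnorm hτ]
    constructor
    · rintro ⟨a, rfl⟩
      exact ⟨a, (mem_fixedField_zpowers_iff τ a).1 a.2, rfl⟩
    · rintro ⟨a, ha, rfl⟩
      exact ⟨⟨a, (mem_fixedField_zpowers_iff τ a).2 ha⟩, rfl⟩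
  exact ⟨((AlgEquiv.ofInjective ι hι).trans (Subalgebra.equivOfEq _ _ hrange)).symm⟩

theorem nonempty_leftIdealiser_algEquiv_of_eq_one (hC : IsTwistedCode C σ σ n 1 η)
    (hσ : orderOf σ = n) (hn : Module.finrank K L = n) (hkn : 2 ≤ n)
    (hnorm : Algebra.norm K η ≠ (-1) ^ n) : Nonempty (leftIdealiser C ≃ₐ[K] L) := by
  have hnorm' : Algebra.norm K (-η) ≠ 1 := by
    intro h
    apply hnorm
    have h2 : Algebra.norm K (-1 : L) = (-1) ^ n := by
      have := Algebra.norm_algebraMap (S := L) (-1 : K)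
      rwa [map_neg, map_one, hn] at this
    rw [← neg_one_mul, map_mul, h2] at h
    have h3 : ((-1 : K) ^ n) * (-1) ^ n = 1 := by rw [← mul_pow]; simp
    exact mul_left_cancel₀ (left_ne_zero_of_mul_eq_one h3) (h.trans h3.symm)
  obtain ⟨e, he⟩ := exists_linearEquiv_sub_smul hnorm' σ
  rw [neg_neg] at he
  have hmem : ∀ a : L, e.toLinearMap ∘ₗ Algebra.lmul K L a ∈ C := by
    intro a
    convert hC.smul_one_add_mem hσ le_rfl hkn a using 1
    rw [he]
    ext x
    simp [mul_assoc]
  have hCD : ∀ f, f ∈ C ↔ e.symm.toLinearMap ∘ₗ f ∈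
      LinearMap.range (Algebra.lmul K L).toLinearMap := by
    classical
    intro f
    constructor
    · intro hf
      refine ⟨galCoeff f 1, ?_⟩
      have h : f = e.toLinearMap ∘ₗ Algebra.lmul K L (galCoeff f 1) := by
        have hg := hmem (galCoeff f 1)
        have h1 : galCoeff (e.toLinearMap ∘ₗ Algebra.lmul K L (galCoeff f 1)) 1
            = galCoeff f 1 := by
          have hne : σ ≠ 1 := by
            rintro rfl
            rw [orderOf_one] at hσ
            omega
          rw [lmul_eq_smul, galCoeff_comp_smul, he, galCoeff_add, galCoeff_smul_toLinearMap,
            galCoeff_smul_toLinearMap]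
          simp [hne]
        rw [hC] at hf hg
        refine galCoeff_ext fun g => ?_
        obtain ⟨j, hj, hjn, rfl⟩ := exists_zpow_eq hσ hn g
        rcases hj.eq_or_lt with rfl | hj
        · rw [zpow_zero, h1]
        rcases (show 1 ≤ j by omega).eq_or_lt with rfl | hj
        · have h2 := hf.2.trans (h1 ▸ hg.2.symm)
          exact h2
        · rw [hf.1 j (by simpa using hj) hjn, hg.1 j (by simpa using hj) hjn]
      conv_rhs => rw [h]
      ext x
      simp
    · rintro ⟨a, ha⟩
      convert hmem a using 1
      ext x
      have := DFunLike.congr_fun ha x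
      simp at this
      simp [this]
  obtain ⟨e1⟩ := nonempty_leftIdealiser_algEquiv_of_comp e.symm hCD
  obtain ⟨e2⟩ := nonempty_range_lmul_algEquiv K L
  exact ⟨(e1.trans (Subalgebra.equivOfEq _ _ leftIdealiser_range_lmul)).trans e2⟩

theorem nonempty_leftIdealiser_algEquiv_of_add_one_eq
    (hC : IsTwistedCode C σ (σ ^ (k : ℤ)) n k η)
    (hσ : orderOf σ = n) (hkn : k + 1 = n) (hη : η ≠ 0)
    (hnorm : Algebra.norm K η ≠ 1) : Nonempty (leftIdealiser C ≃ₐ[K] L) := by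
  have hnorm' : Algebra.norm K (σ η⁻¹) ≠ 1 := by
    rw [Algebra.norm_eq_of_algEquiv, norm_inv_eq_inv_norm hη]
    simpa using hnorm
  obtain ⟨e, he⟩ := exists_linearEquiv_sub_smul hnorm' σ
  have hσk : σ * σ ^ (k : ℤ) = 1 := by
    rw [zpow_natCast, ← pow_succ', hkn, ← hσ, pow_orderOf_eq_one]
  have hCD : ∀ f, f ∈ C ↔ e.toLinearMap ∘ₗ f ∈ galCoeffOneKer K L := by
    intro f
    rw [hC, mem_galCoeffOneKer, he, LinearMap.add_comp, galCoeff_add, galCoeff_smul_comp,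
      galCoeff_smul_comp, mul_one, mul_one, inv_one, inv_eq_of_mul_eq_one_right hσk]
    rw [and_iff_right fun j hj hjn => by omega]
    rw [← σ.injective.eq_iff, map_mul, ← AlgEquiv.mul_apply, hσk]
    have : σ η ≠ 0 := by simpa using hη
    simp only [AlgEquiv.one_apply, map_inv₀]
    field_simp
    constructor
    · intro h
      linear_combination -h
    · intro h
      linear_combination -h
  obtain ⟨e1⟩ := nonempty_leftIdealiser_algEquiv_of_comp e hCD
  obtain ⟨e2⟩ := nonempty_range_lmul_algEquiv K L
  exact ⟨(e1.trans (Subalgebra.equivOfEq _ _ leftIdealiser_galCoeffOneKer)).trans e2⟩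

/-- In the exceptional cases the left idealiser is isomorphic to the whole field. -/
theorem nonempty_leftIdealiser_algEquiv (hC : IsTwistedCode C σ τ n k η)
    (hσ : orderOf σ = n) (hn : Module.finrank K L = n) (hkn : k + 1 ≤ n) (hη : η ≠ 0)
    (hnorm : Algebra.norm K η ≠ (-1) ^ (n * k)) (hk : k = 1 ∨ k + 1 = n)
    (hτ : τ = σ ^ (k : ℤ)) : Nonempty (leftIdealiser C ≃ₐ[K] L) := by
  subst hτ
  rcases hk with rfl | hk
  · rw [Nat.cast_one, zpow_one] at hC
    exact hC.nonempty_leftIdealiser_algEquiv_of_eq_one hσ hn hkn (by simpa using hnorm)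
  · refine hC.nonempty_leftIdealiser_algEquiv_of_add_one_eq hσ hk hη ?_
    have : Even (n * k) := by
      rw [← hk, mul_comm]
      exact Nat.even_mul_succ_self k
    rwa [this.neg_one_pow] at hnorm

/-- The composition of the adjoint of a twisted code with `σ ^ k` is again a twisted code. -/
theorem mem_iff_comp_traceAdjoint_mem (hC : IsTwistedCode C σ τ n k η) (hσ : orderOf σ = n)
    (hη : η ≠ 0)
    (hC' : IsTwistedCode C' σ (σ ^ (k : ℤ) * τ⁻¹) n k ((σ ^ (k : ℤ) * τ⁻¹) η⁻¹))
    (f : Module.End K L) :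
    f ∈ C ↔ (σ ^ (k : ℤ)).toLinearMap ∘ₗ traceAdjoint K L f ∈ C' := by
  have h : ∀ j : ℤ, galCoeff ((σ ^ (k : ℤ)).toLinearMap ∘ₗ traceAdjoint K L f) (σ ^ j)
      = (σ ^ j) (galCoeff f (σ ^ (k - j))) := by
    intro j
    rw [← one_smul L (σ ^ (k : ℤ)).toLinearMap, galCoeff_smul_comp, one_mul,
      galCoeff_traceAdjoint, ← AlgEquiv.mul_apply, mul_inv_cancel_left, mul_inv_rev, inv_inv,
      ← zpow_neg, ← zpow_add, neg_add_eq_sub]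
  have h0 := h 0
  rw [zpow_zero, sub_zero, AlgEquiv.one_apply] at h0
  rw [hC, hC', h0]
  simp only [h, sub_self, zpow_zero]
  refine and_congr ⟨fun hf j hj hjn => ?_, fun hf j hj hjn => ?_⟩ ?_
  · have := hf (k - j + n) (by omega) (by omega)
    rw [← galCoeff_zpow_sub hσ, add_sub_cancel_right] at this
    rw [this, map_zero]
  · have := hf (k - j + n) (by omega) (by omega)
    rw [map_eq_zero_iff _ (AlgEquiv.injective _)] at this
    rw [← this, ← galCoeff_zpow_sub hσ]
    congr 2
    ring
  · rw [← map_mul, AlgEquiv.mul_apply, (AlgEquiv.injective _).eq_iff,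
      ← (AlgEquiv.injective τ).eq_iff (b := τ⁻¹ _), ← AlgEquiv.mul_apply τ, mul_inv_cancel,
      AlgEquiv.one_apply, eq_inv_mul_iff_mul_eq₀ hη, eq_comm]

/-- The right idealiser of a twisted code is isomorphic to the left idealiser of its adjoint, if
the latter is commutative. -/
theorem nonempty_rightIdealiser_algEquiv (hC : IsTwistedCode C σ τ n k η) (hσ : orderOf σ = n)
    (hη : η ≠ 0)
    (hC' : IsTwistedCode C' σ (σ ^ (k : ℤ) * τ⁻¹) n k ((σ ^ (k : ℤ) * τ⁻¹) η⁻¹))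
    {A : Type*} [CommRing A] [Algebra K A] (e : Nonempty (leftIdealiser C' ≃ₐ[K] A)) :
    Nonempty (rightIdealiser C ≃ₐ[K] A) := by
  set s : L ≃ₗ[K] L := (σ ^ (k : ℤ)).toLinearEquiv with hs
  have hCC' : ∀ f, f ∈ C ↔ s.toLinearMap ∘ₗ traceAdjoint K L f ∈ C' :=
    hC.mem_iff_comp_traceAdjoint_mem hσ hη hC'
  have hθ : ∀ φ, (traceAdjoint K L).trans s.conj φ
      = s.toLinearMap ∘ₗ traceAdjoint K L φ ∘ₗ s.symm.toLinearMap := fun φ => rfl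
  refine nonempty_algEquiv_of_antiAutomorphism ((traceAdjoint K L).trans s.conj) ?_ ?_ ?_ e
  · rw [hθ, traceAdjoint_one]
    ext x
    simp
  · intro f g
    rw [hθ, hθ, hθ, Module.End.mul_eq_comp, traceAdjoint_comp]
    ext x
    simp
  · intro φ
    rw [hθ]
    constructor
    · intro hφ f hf
      have hf' : f = s.toLinearMap ∘ₗ traceAdjoint K L
          ((traceAdjoint K L).symm (s.symm.toLinearMap ∘ₗ f)) := by
        rw [LinearEquiv.apply_symm_apply]
        ext x
        simp
      rw [hf', ← hCC'] at hf
      have := (hCC' _).1 (hφ _ hf)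
      rw [traceAdjoint_comp, LinearEquiv.apply_symm_apply] at this
      exact this
    · intro hφ f hf
      rw [hCC'] at hf ⊢
      have := hφ _ hf
      rw [traceAdjoint_comp]
      convert this using 1
      ext x
      simp

end IsTwistedCode

end TwistedCode

theorem orderOf_zpow_eq_div_gcd {G : Type*} [Group G] [Finite G] (g : G) (m : ℤ) :
    orderOf (g ^ m) = orderOf g / Int.gcd (orderOf g) m := by
  have h : orderOf (g ^ m) = orderOf (g ^ m.natAbs) := by
    rcases Int.natAbs_eq m with hm | hm
    · conv_lhs => rw [hm, zpow_natCast]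
    · conv_lhs => rw [hm, zpow_neg, zpow_natCast, orderOf_inv]
  rw [h, orderOf_pow]
  rfl

section TwistedGabidulin

variable {Fq F : Type*} [Field Fq] [Fintype Fq] [Field F] [Finite F] [Algebra Fq F]

theorem qFrob_mul (i j : ℤ) : qFrob Fq F (i * j) = qFrob Fq F i ^ j :=
  zpow_mul _ i j

theorem qFrob_sub (i j : ℤ) : qFrob Fq F (i - j) = qFrob Fq F i * (qFrob Fq F j)⁻¹ :=
  zpow_sub _ i j

theorem orderOf_qFrob {n : ℕ} (hn : Module.finrank Fq F = n) (m : ℤ) :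
    orderOf (qFrob Fq F m) = n / Int.gcd n m := by
  rw [qFrob, orderOf_zpow_eq_div_gcd, FiniteField.orderOf_frobeniusAlgEquivOfAlgebraic, hn]

theorem qFrob_eq_qFrob_iff {n : ℕ} (hn : Module.finrank Fq F = n) {i j : ℤ} :
    qFrob Fq F i = qFrob Fq F j ↔ i ≡ j [ZMOD n] := by
  rw [qFrob, qFrob, zpow_eq_zpow_iff_modEq, FiniteField.orderOf_frobeniusAlgEquivOfAlgebraic, hn]

theorem finrank_fixedField_qFrob {n : ℕ} (hn : Module.finrank Fq F = n) (m : ℤ) :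
    Module.finrank Fq (IntermediateField.fixedField (Subgroup.zpowers (qFrob Fq F m)))
      = Int.gcd n m := by
  have h := Module.finrank_mul_finrank Fq
    (IntermediateField.fixedField (Subgroup.zpowers (qFrob Fq F m))) F
  rw [IntermediateField.finrank_fixedField_eq_card, Nat.card_zpowers, orderOf_qFrob hn, hn] at h
  have hpos : 0 < n := hn ▸ Module.finrank_pos
  have hdvd : Int.gcd n m ∣ n := by exact_mod_cast Int.gcd_dvd_left (n : ℤ) m
  refine Nat.eq_of_mul_eq_mul_right (Nat.div_pos (Nat.le_of_dvd hpos hdvd)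
    (Nat.pos_of_dvd_of_pos hdvd hpos)) (h.trans (Nat.mul_div_cancel' hdvd).symm)

theorem isTwistedCode_twistedGabidulin {n k : ℕ} {s : ℤ} (h : ℤ) (η : F)
    (hn : Module.finrank Fq F = n) (hσ : orderOf (qFrob Fq F s) = n) (hk : 1 ≤ k)
    (hkn : k + 1 ≤ n) :
    IsTwistedCode (twistedGabidulin Fq k s η h) (qFrob Fq F s) (qFrob Fq F h) n k η := by
  classical
  set σ := qFrob Fq F s with hs
  have hne : ∀ i j : ℤ, 0 ≤ i → i < n → 0 ≤ j → j < n → i ≠ j → σ ^ i ≠ σ ^ j :=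
    fun i j hi hin hj hjn hij h => hij (eq_of_zpow_eq_zpow hσ hi hin hj hjn h)
  intro f
  constructor
  · rintro ⟨a, ha⟩
    have hf : f = ∑ i ∈ Finset.range k, a i • ((σ ^ (i : ℤ)).toLinearMap : Module.End Fq F)
        + (qFrob Fq F h (a 0) * η) • ((σ ^ (k : ℤ)).toLinearMap : Module.End Fq F) := by
      ext x
      rw [ha]
      simp [LinearMap.sum_apply, qFrob_mul, hs]
    have hcoeff : ∀ j : ℤ, galCoeff f (σ ^ j)
        = ∑ i ∈ Finset.range k, (if σ ^ (i : ℤ) = σ ^ j then a i else 0)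
          + if σ ^ (k : ℤ) = σ ^ j then qFrob Fq F h (a 0) * η else 0 := by
      intro j
      rw [hf, galCoeff_add, galCoeff_sum]
      simp only [galCoeff_smul_toLinearMap]
    have hhigh : ∀ j : ℤ, k ≤ j → j < n →
        ∑ i ∈ Finset.range k, (if σ ^ (i : ℤ) = σ ^ j then a i else 0) = 0 := by
      intro j hj hjn
      refine Finset.sum_eq_zero fun i hi => if_neg ?_
      rw [Finset.mem_range] at hi
      exact hne _ _ (by omega) (by omega) (by omega) hjn (by omega)
    have hzero : galCoeff f 1 = a 0 := by
      have h0 := hcoeff 0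
      rw [zpow_zero] at h0
      rw [h0, Finset.sum_eq_single 0, if_pos (by simp), if_neg, add_zero]
      · rw [← zpow_zero σ]
        exact hne _ _ (by omega) (by omega) le_rfl (by omega) (by omega)
      · intro i hi hi0
        rw [Finset.mem_range] at hi
        rw [if_neg]
        rw [← zpow_zero σ]
        exact hne _ _ (by omega) (by omega) le_rfl (by omega) (by omega)
      · intro h0
        simp at h0
        omega
    refine ⟨fun j hj hjn => ?_, ?_⟩
    · rw [hcoeff, hhigh j hj.le hjn, if_neg, add_zero]
      exact hne _ _ (by omega) (by omega) (by omega) hjn (by omega)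
    · rw [hcoeff, hhigh k le_rfl (by omega), if_pos rfl, zero_add, hzero, mul_comm]
  · rintro ⟨hf, hf0⟩
    refine ⟨fun i => galCoeff f (σ ^ (i : ℤ)), fun x => ?_⟩
    have hsum : f = ∑ i ∈ Finset.range n,
        galCoeff f (σ ^ (i : ℤ)) • ((σ ^ (i : ℤ)).toLinearMap : Module.End Fq F) := by
      conv_lhs => rw [← sum_galCoeff_smul f]
      rw [Finset.sum_range, ← (bijective_pow_of_orderOf_eq hσ hn).sum_comp]
      simp only [zpow_natCast]
    have hsub : ∑ i ∈ Finset.range (k + 1),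
        galCoeff f (σ ^ (i : ℤ)) • ((σ ^ (i : ℤ)).toLinearMap : Module.End Fq F) = f := by
      conv_rhs => rw [hsum]
      refine Finset.sum_subset (Finset.range_subset_range.2 hkn) fun i hi hik => ?_
      rw [Finset.mem_range] at hi hik
      rw [hf i (by omega) (by omega), zero_smul]
    have hx := DFunLike.congr_fun hsub x
    rw [Finset.sum_range_succ, hf0] at hx
    rw [← hx]
    simp [LinearMap.sum_apply, qFrob_mul, hs, mul_comm η]

end TwistedGabidulin

/-- The idealisers of the generalized twisted Gabidulin code `H_{k,s}(η,h)`, `η ≠ 0`. The left one is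
the field with `q ^ gcd(n,h)` elements and the right one the field with `q ^ gcd(n,sk-h)` elements,
except in the degenerate cases `k ∈ {1, n-1}` with `h ≡ sk`, resp. `h ≡ 0`, modulo `n`, in which it is
the field `F` with `q ^ n` elements. -/
theorem twisted_gabidulin_idealisers
    (Fq F : Type*) [Field Fq] [Fintype Fq] [Field F] [Finite F] [Algebra Fq F]
    (n k : ℕ) (s h : ℤ) (hn : Module.finrank Fq F = n)
    (hs : Int.gcd s n = 1) (hk : 1 ≤ k) (hkn : k + 1 ≤ n)
    (η : F) (hη : η ≠ 0) (hnorm : Algebra.norm Fq η ≠ (-1) ^ (n * k)) :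
    (¬ ((k = 1 ∨ k + 1 = n) ∧ h ≡ s * k [ZMOD n]) →
      ∃ E : IntermediateField Fq F, Module.finrank Fq E = Int.gcd n h ∧
        Nonempty (leftIdealiser (twistedGabidulin Fq k s η h) ≃ₐ[Fq] E)) ∧
    (¬ ((k = 1 ∨ k + 1 = n) ∧ h ≡ 0 [ZMOD n]) →
      ∃ E : IntermediateField Fq F, Module.finrank Fq E = Int.gcd n (s * k - h) ∧
        Nonempty (rightIdealiser (twistedGabidulin Fq k s η h) ≃ₐ[Fq] E)) ∧
    ((k = 1 ∨ k + 1 = n) ∧ h ≡ s * k [ZMOD n] →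
      Nonempty (leftIdealiser (twistedGabidulin Fq k s η h) ≃ₐ[Fq] F)) ∧
    ((k = 1 ∨ k + 1 = n) ∧ h ≡ 0 [ZMOD n] →
      Nonempty (rightIdealiser (twistedGabidulin Fq k s η h) ≃ₐ[Fq] F)) := by
  have hσ : orderOf (qFrob Fq F s) = n := by
    rw [orderOf_qFrob hn, Int.gcd_comm, hs, Nat.div_one]
  have hC := isTwistedCode_twistedGabidulin h η hn hσ hk hkn
  have hτ : h ≡ s * k [ZMOD n] ↔ qFrob Fq F h = qFrob Fq F s ^ (k : ℤ) := by
    rw [← qFrob_mul, qFrob_eq_qFrob_iff hn]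
  set η' : F := qFrob Fq F (s * k - h) η⁻¹ with hη'_def
  have hη' : η' ≠ 0 := by simpa [hη'_def] using hη
  have hnorm' : Algebra.norm Fq η' ≠ (-1) ^ (n * k) := by
    rw [hη'_def, Algebra.norm_eq_of_algEquiv, norm_inv_eq_inv_norm hη]
    intro h
    apply hnorm
    rw [← inv_inv (Algebra.norm Fq η), h, ← inv_pow, inv_neg_one]
  have hC' := isTwistedCode_twistedGabidulin (s * k - h) η' hn hσ hk hkn
  have hτ' : h ≡ 0 [ZMOD n] ↔ qFrob Fq F (s * k - h) = qFrob Fq F s ^ (k : ℤ) := by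
    rw [← qFrob_mul, qFrob_eq_qFrob_iff hn, Int.modEq_zero_iff_dvd, Int.modEq_iff_dvd,
      sub_sub_cancel]
  have hright {A : Type _} [CommRing A] [Algebra Fq A]
      (e : Nonempty (leftIdealiser (twistedGabidulin Fq k s η' (s * k - h)) ≃ₐ[Fq] A)) :
      Nonempty (rightIdealiser (twistedGabidulin Fq k s η h) ≃ₐ[Fq] A) := by
    refine hC.nonempty_rightIdealiser_algEquiv hσ hη ?_ e
    rw [← qFrob_mul, ← qFrob_sub]
    exact hC'
  rw [hτ, hτ']
  refine ⟨fun hex => ⟨_, finrank_fixedField_qFrob hn h, ?_⟩,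
    fun hex => ⟨_, finrank_fixedField_qFrob hn (s * k - h), hright ?_⟩, fun hex => ?_,
    fun hex => hright ?_⟩
  · exact hC.nonempty_leftIdealiser_algEquiv_fixedField hσ hn hk hkn hη hnorm hex
  · exact hC'.nonempty_leftIdealiser_algEquiv_fixedField hσ hn hk hkn hη' hnorm' hex
  · exact hC.nonempty_leftIdealiser_algEquiv hσ hn hkn hη hnorm hex.1 hex.2
  · exact hC'.nonempty_leftIdealiser_algEquiv hσ hn hkn hη' hnorm' hex.1 hex.2
end

section
/- Let $q$ be a prime power and let $1 \le k \le n-1$. Regard $q$-polynomials $f(x)=\sum_{i=0}^{n-1}a_ix^{q^i}$ over $\mathbb F_{q^n}$, taken modulo $x^{q^n}-x$, as $\mathbb F_q$-linear maps of $\mathbb F_{q^n}$. Let $C$ be an $\mathbb F_{q^n}$-linear MRD code of $q$-polynomials of dimension $k$, that is, a $k$-dimensional $\mathbb F_{q^n}$-subspace all of whose nonzero elements have rank at least $n-k+1$. Two codes $C, C'$ are called equivalent if $C'=\{h\circ f^\sigma\circ g : f\in C\}$ for some invertible $q$-polynomials $h,g$ and some automorphism $\sigma$ of $\mathbb F_{q^n}$,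 where $f^\sigma(x)=\sum_i \sigma(a_i)x^{q^i}$. Then $C$ is equivalent to a generalized Gabidulin code $$G_{k,s}=\langle x,x^{q^s},\dots,x^{q^{s(k-1)}}\rangle_{\mathbb F_{q^n}}\quad\text{for some } s \text{ with } \gcd(s,n)=1$$ if and only if there exists an integer $0\le s<n$ with $\gcd(s,n)=1$ such that $$\dim_{\mathbb F_{q^n}}\bigl(C\cap C^{[s]}\bigr)=k-1,$$ where $C^{[s]}=\{f(x)^{q^s} : f\in C\}$ and $f(x)^{q^s}=\sum_i a_i^{q^s}x^{q^{i+s}}$ modulo $x^{q^n}-x$ is the $q^s$-th power of the whole polynomial. -/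
/-! A `q`-polynomial `∑ i, a i * x ^ (q ^ i)` over a finite extension `F` of `Fq`, with
`q = |Fq|` and `n = [F : Fq]`, is represented by its coefficient vector `a : Fin n → F`. -/

section QPoly

variable (Fq : Type*) [Field Fq] [Fintype Fq] {F : Type*} [Field F] [Fintype F] [Algebra Fq F]

theorem add_pow_card_base {K : Type*} [Field K] [Algebra Fq K] (x y : K) (m : ℕ) :
    (x + y) ^ Fintype.card Fq ^ m = x ^ Fintype.card Fq ^ m + y ^ Fintype.card Fq ^ m := by
  have h := map_add (FiniteField.frobeniusAlgHom Fq K ^ m) x y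
  simpa only [AlgHom.coe_pow, FiniteField.coe_frobeniusAlgHom, pow_iterate] using h

/-- The `Fq`-linear map `x ↦ ∑ i, a i * x ^ (q ^ i)` of `F` given by a `q`-polynomial. -/
def qeval {n : ℕ} (a : Fin n → F) : F →ₗ[Fq] F where
  toFun x := ∑ i : Fin n, a i * x ^ Fintype.card Fq ^ (i : ℕ)
  map_add' x y := by
    simp only [add_pow_card_base, mul_add, Finset.sum_add_distrib]
  map_smul' c x := by
    simp only [smul_pow, FiniteField.pow_card_pow, mul_smul_comm, Finset.smul_sum,
      RingHom.id_apply]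

/-- The rank of a `q`-polynomial: the rank of the `Fq`-linear map that it defines. -/
noncomputable def qrank {n : ℕ} (a : Fin n → F) : ℕ :=
  Module.finrank Fq (LinearMap.range (qeval Fq a))

/-- Composition `a ∘ b` of `q`-polynomials, reduced modulo `x ^ (q ^ n) - x`; the index `k - i`
is taken modulo `n`. -/
def qcomp {n : ℕ} (a b : Fin n → F) : Fin n → F :=
  fun k => ∑ i : Fin n, a i * b (k - i) ^ Fintype.card Fq ^ (i : ℕ)

/-- Equivalence of codes of `q`-polynomials: `C' = {h ∘ f^σ ∘ g : f ∈ C}` with invertible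
`q`-polynomials `h`, `g` and a field automorphism `σ` of `F`, applied to the coefficients
of `f`. -/
def CodeEquiv {n : ℕ} (C C' : Set (Fin n → F)) : Prop :=
  ∃ (h g : Fin n → F) (σ : F ≃+* F),
    Function.Bijective (qeval Fq h) ∧ Function.Bijective (qeval Fq g) ∧
    C' = (fun f => qcomp Fq h (qcomp Fq (fun i => σ (f i)) g)) '' C

variable (F) in
/-- The monomial `x ^ (q ^ m)`, reduced modulo `x ^ (q ^ n) - x`. -/
def qmono (n m : ℕ) : Fin n → F :=
  fun j => if (j : ℕ) = m % n then 1 else 0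

variable (F) in
/-- The generalized Gabidulin code
`G_{k,s} = ⟨x, x ^ (q ^ s), …, x ^ (q ^ (s * (k - 1)))⟩` over `F`. -/
def Gcode (n k s : ℕ) : Submodule F (Fin n → F) :=
  Submodule.span F (Set.range fun i : Fin k => qmono F n (s * (i : ℕ)))

/-- The power `f(x) ^ (q ^ s)` of a `q`-polynomial, reduced modulo `x ^ (q ^ n) - x`: the
coefficients are raised to the power `q ^ s` and shifted cyclically by `s` places, so that the
coefficient at `j` comes from the one at `j - s` modulo `n`. -/
def qpow {n : ℕ} (s : ℕ) (f : Fin n → F) : Fin n → F :=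
  fun j => f ⟨((j : ℕ) + (n - s % n)) % n, Nat.mod_lt _ j.pos⟩ ^ Fintype.card Fq ^ s

/-- The code `C^{[s]} = {f(x) ^ (q ^ s) : f ∈ C}`, which is again a subspace over `F`. -/
def powCode {n : ℕ} (s : ℕ) (C : Submodule F (Fin n → F)) : Submodule F (Fin n → F) where
  carrier := qpow Fq s '' (C : Set (Fin n → F))
  add_mem' := by
    rintro _ _ ⟨f, hf, rfl⟩ ⟨g, hg, rfl⟩
    exact ⟨f + g, C.add_mem hf hg, funext fun j => add_pow_card_base Fq _ _ s⟩
  zero_mem' := ⟨0, C.zero_mem, funext fun j =>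
    zero_pow (pow_ne_zero s (Fintype.card_ne_zero (α := Fq)))⟩
  smul_mem' := by
    rintro c _ ⟨f, hf, rfl⟩
    have hinj : Function.Injective fun x : F => x ^ Fintype.card Fq ^ s := by
      have h := (FiniteField.frobeniusAlgHom Fq F ^ s).toRingHom.injective
      intro x y hxy
      apply h
      simpa [AlgHom.coe_pow, FiniteField.coe_frobeniusAlgHom, pow_iterate] using hxy
    obtain ⟨d, rfl⟩ := (Finite.injective_iff_surjective.1 hinj) c
    exact ⟨d • f, C.smul_mem d hf, funext fun j => mul_pow _ _ _⟩

end QPoly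

set_option linter.unusedSectionVars false

section Evaluation

variable {Fq F : Type*} [Field Fq] [Fintype Fq] [Field F] [Fintype F] [Algebra Fq F] {n : ℕ}

theorem qeval_apply (a : Fin n → F) (x : F) :
    qeval Fq a x = ∑ i : Fin n, a i * x ^ Fintype.card Fq ^ (i : ℕ) := rfl

theorem frobeniusAlgHom_pow_apply (m : ℕ) (x : F) :
    (FiniteField.frobeniusAlgHom Fq F ^ m) x = x ^ Fintype.card Fq ^ m := by
  simp [AlgHom.coe_pow, FiniteField.coe_frobeniusAlgHom, pow_iterate]

theorem pow_card_base_injective (m : ℕ) :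
    Function.Injective fun x : F => x ^ Fintype.card Fq ^ m := by
  intro x y hxy
  apply (FiniteField.frobeniusAlgHom Fq F ^ m).toRingHom.injective
  simpa [frobeniusAlgHom_pow_apply] using hxy

theorem sum_pow_card_base {ι : Type*} (S : Finset ι) (f : ι → F) (m : ℕ) :
    (∑ i ∈ S, f i) ^ Fintype.card Fq ^ m = ∑ i ∈ S, f i ^ Fintype.card Fq ^ m := by
  simpa only [frobeniusAlgHom_pow_apply] using
    map_sum (FiniteField.frobeniusAlgHom Fq F ^ m) f S

theorem pow_card_base_finrank (hn : Module.finrank Fq F = n) (x : F) :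
    x ^ Fintype.card Fq ^ n = x := by
  subst hn
  rw [← Module.card_eq_pow_finrank (K := Fq) (V := F), FiniteField.pow_card]

theorem pow_card_base_add (x : F) (a b : ℕ) :
    x ^ Fintype.card Fq ^ (a + b) = (x ^ Fintype.card Fq ^ a) ^ Fintype.card Fq ^ b := by
  rw [pow_add, pow_mul]

theorem pow_card_base_mod (hn : Module.finrank Fq F = n) (x : F) (m : ℕ) :
    x ^ Fintype.card Fq ^ (m % n) = x ^ Fintype.card Fq ^ m := by
  have hper : ∀ (t : ℕ) (y : F), y ^ Fintype.card Fq ^ (n * t) = y := by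
    intro t
    induction t with
    | zero => simp
    | succ t ih => intro y; rw [Nat.mul_succ, pow_card_base_add, ih, pow_card_base_finrank hn]
  conv_rhs => rw [← Nat.mod_add_div m n, pow_card_base_add, hper]

/-- An element of `F` fixed by the `s`-th power of the Frobenius, `s` coprime to `[F : Fq]`,
lies in `Fq`. -/
theorem mem_range_algebraMap_of_pow_card_base_eq (hn : Module.finrank Fq F = n) {s : ℕ}
    (hs : Nat.gcd s n = 1) {x : F} (hx : x ^ Fintype.card Fq ^ s = x) :
    x ∈ Set.range (algebraMap Fq F) := by
  have h1 : Function.IsPeriodicPt (fun y : F => y ^ Fintype.card Fq) s x := by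
    simpa [Function.IsPeriodicPt, Function.IsFixedPt, pow_iterate] using hx
  have h2 : Function.IsPeriodicPt (fun y : F => y ^ Fintype.card Fq) n x := by
    simpa [Function.IsPeriodicPt, Function.IsFixedPt, pow_iterate] using
      pow_card_base_finrank hn x
  have h3 := h1.gcd h2
  rw [hs] at h3
  have h4 : x ^ Fintype.card Fq = x := by
    simpa [Function.IsPeriodicPt, Function.IsFixedPt] using h3
  rw [IsGalois.mem_range_algebraMap_iff_fixed]
  intro e
  obtain ⟨m, hm⟩ := (FiniteField.bijective_frobeniusAlgHom_pow Fq F).2 e.toAlgHom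
  have h5 : (e : F → F) x = (FiniteField.frobeniusAlgHom Fq F ^ m.1) x :=
    (DFunLike.congr_fun hm x).symm
  rw [h5, AlgHom.coe_pow, FiniteField.coe_frobeniusAlgHom]
  exact Function.iterate_fixed h4 _

/-- Evaluation of `q`-polynomials as an `F`-linear map. -/
def qevalLinear (Fq F : Type*) [Field Fq] [Fintype Fq] [Field F] [Fintype F] [Algebra Fq F]
    (n : ℕ) : (Fin n → F) →ₗ[F] (F →ₗ[Fq] F) where
  toFun := qeval Fq
  map_add' a b := by
    ext x; simp [qeval_apply, add_mul, Finset.sum_add_distrib]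
  map_smul' c a := by
    ext x; simp [qeval_apply, mul_assoc, Finset.mul_sum]

theorem qeval_add (a b : Fin n → F) (x : F) :
    qeval Fq (a + b) x = qeval Fq a x + qeval Fq b x :=
  DFunLike.congr_fun ((qevalLinear Fq F n).map_add a b) x

theorem qeval_sub (a b : Fin n → F) (x : F) :
    qeval Fq (a - b) x = qeval Fq a x - qeval Fq b x :=
  DFunLike.congr_fun ((qevalLinear Fq F n).map_sub a b) x

theorem qeval_smul (c : F) (a : Fin n → F) (x : F) :
    qeval Fq (c • a) x = c * qeval Fq a x :=
  DFunLike.congr_fun ((qevalLinear Fq F n).map_smul c a) x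

theorem qeval_injective (hn : Module.finrank Fq F = n) :
    Function.Injective (qeval Fq : (Fin n → F) → (F →ₗ[Fq] F)) := by
  subst hn
  have hinj : Function.Injective fun i : Fin (Module.finrank Fq F) =>
      ((FiniteField.frobeniusAlgHom Fq F ^ i.1 : F →ₐ[Fq] F) : F →* F) := by
    intro i j hij
    apply (FiniteField.bijective_frobeniusAlgHom_pow Fq F).1
    ext x
    exact DFunLike.congr_fun hij x
  have hli := (linearIndependent_monoidHom F F).comp _ hinj
  rw [Fintype.linearIndependent_iff] at hli
  change Function.Injective (qevalLinear Fq F _)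
  rw [← LinearMap.ker_eq_bot, LinearMap.ker_eq_bot']
  intro a ha
  funext i
  apply hli a
  funext x
  have := DFunLike.congr_fun ha x
  simpa [qevalLinear, qeval_apply, Finset.sum_apply, AlgHom.coe_pow,
    FiniteField.coe_frobeniusAlgHom, pow_iterate] using! this

theorem qeval_ext (hn : Module.finrank Fq F = n) {a b : Fin n → F}
    (h : ∀ x, qeval Fq a x = qeval Fq b x) : a = b :=
  qeval_injective hn (LinearMap.ext h)

theorem qeval_surjective (hn : Module.finrank Fq F = n) :
    Function.Surjective (qeval Fq : (Fin n → F) → (F →ₗ[Fq] F)) := by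
  have h : Function.Injective (qevalLinear Fq F n) := qeval_injective hn
  have : Function.Surjective (qevalLinear Fq F n) := by
    rwa [← LinearMap.injective_iff_surjective_of_finrank_eq_finrank]
    rw [Module.finrank_linearMap_self, hn, Module.finrank_fin_fun]
  exact this

theorem qeval_qcomp (hn : Module.finrank Fq F = n) (a b : Fin n → F) (x : F) :
    qeval Fq (qcomp Fq a b) x = qeval Fq a (qeval Fq b x) := by
  have : NeZero n := ⟨by rw [← hn]; exact Module.finrank_pos.ne'⟩
  simp only [qeval_apply, qcomp, Finset.sum_mul, sum_pow_card_base, Finset.mul_sum]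
  rw [Finset.sum_comm]
  refine Finset.sum_congr rfl fun i _ => ?_
  refine Fintype.sum_equiv (Equiv.subRight i) _ _ fun k => ?_
  rw [Equiv.subRight_apply, mul_pow, mul_assoc, ← pow_card_base_add]
  congr 2
  rw [← pow_card_base_mod hn x ((k - i : Fin n) + (i : ℕ)), ← Fin.val_add, sub_add_cancel]

theorem qeval_qmono (hn : Module.finrank Fq F = n) (m : ℕ) (x : F) :
    qeval Fq (qmono F n m) x = x ^ Fintype.card Fq ^ m := by
  have hpos : 0 < n := by rw [← hn]; exact Module.finrank_pos
  rw [qeval_apply, Finset.sum_eq_single (⟨m % n, Nat.mod_lt _ hpos⟩ : Fin n)]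
  · simp [qmono, pow_card_base_mod hn]
  · intro j _ hj
    have : (j : ℕ) ≠ m % n := fun h => hj (Fin.ext h)
    simp [qmono, this]
  · simp

theorem qeval_qpow (hn : Module.finrank Fq F = n) (s : ℕ) (f : Fin n → F) (x : F) :
    qeval Fq (qpow Fq s f) x = qeval Fq f x ^ Fintype.card Fq ^ s := by
  have hpos : 0 < n := by rw [← hn]; exact Module.finrank_pos
  have : NeZero n := ⟨hpos.ne'⟩
  have hs : s % n < n := Nat.mod_lt _ hpos
  simp only [qeval_apply, qpow, sum_pow_card_base, mul_pow]
  refine Fintype.sum_equiv (Equiv.subRight (⟨s % n, hs⟩ : Fin n)) _ _ fun k => ?_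
  have hidx : (⟨((k : ℕ) + (n - s % n)) % n, Nat.mod_lt _ k.pos⟩ : Fin n) = k - ⟨s % n, hs⟩ :=
    Fin.ext (by rw [Fin.val_sub, add_comm])
  rw [Equiv.subRight_apply, ← hidx, ← pow_card_base_add]
  congr 1
  rw [← pow_card_base_mod hn x (_ + s)]
  congr 2
  have hk := k.2
  have hd := Nat.mod_add_div s n
  simp only [Nat.mod_add_mod]
  have : (k : ℕ) + (n - s % n) + s = k + n * (s / n + 1) := by
    rw [Nat.mul_succ]; omega
  rw [this, Nat.add_mul_mod_self_left, Nat.mod_eq_of_lt hk]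

theorem qeval_qpow_iterate (hn : Module.finrank Fq F = n) (s i : ℕ) (f : Fin n → F) (x : F) :
    qeval Fq ((qpow Fq s)^[i] f) x = qeval Fq f x ^ Fintype.card Fq ^ (s * i) := by
  induction i with
  | zero => simp
  | succ i ih =>
    rw [Function.iterate_succ_apply', qeval_qpow hn, ih, Nat.mul_succ, pow_card_base_add]

theorem qeval_map_ringEquiv (σ : F ≃+* F) (f : Fin n → F) (x : F) :
    qeval Fq (fun i => σ (f i)) x = σ (qeval Fq f (σ.symm x)) := by
  simp [qeval_apply]

end Evaluation

section PowCode

variable {Fq F : Type*} [Field Fq] [Fintype Fq] [Field F] [Fintype F] [Algebra Fq F] {n : ℕ}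

theorem qpow_injective (hn : Module.finrank Fq F = n) (s : ℕ) :
    Function.Injective (qpow Fq s : (Fin n → F) → (Fin n → F)) := by
  intro f g h
  refine qeval_ext hn fun x => pow_card_base_injective (Fq := Fq) s ?_
  simp only [← qeval_qpow hn, h]

theorem qpow_mem_powCode {s : ℕ} {U : Submodule F (Fin n → F)} {f : Fin n → F} (hf : f ∈ U) :
    qpow Fq s f ∈ powCode Fq s U := ⟨f, hf, rfl⟩

theorem powCode_mono (s : ℕ) {U W : Submodule F (Fin n → F)} (h : U ≤ W) :
    powCode Fq s U ≤ powCode Fq s W := by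
  rintro _ ⟨f, hf, rfl⟩
  exact qpow_mem_powCode (h hf)

/-- Subspaces over a finite field with the same number of elements have the same dimension. -/
theorem finrank_eq_of_ncard_eq {V : Type*} [AddCommGroup V] [Module F V] [Module.Finite F V]
    {U W : Submodule F V} (h : (U : Set V).ncard = (W : Set V).ncard) :
    Module.finrank F U = Module.finrank F W := by
  have hU := Module.natCard_eq_pow_finrank (K := F) (V := U)
  have hW := Module.natCard_eq_pow_finrank (K := F) (V := W)
  have h' : Nat.card U = Nat.card W := h
  rw [h', hW] at hU
  exact (Nat.pow_right_injective (by
    rw [Nat.card_eq_fintype_card]; exact Fintype.one_lt_card) hU).symm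

theorem finrank_powCode (hn : Module.finrank Fq F = n) (s : ℕ) (U : Submodule F (Fin n → F)) :
    Module.finrank F (powCode Fq s U) = Module.finrank F U :=
  finrank_eq_of_ncard_eq (Set.ncard_image_of_injective _ (qpow_injective hn s))

theorem qeval_ne_zero (hn : Module.finrank Fq F = n) {f : Fin n → F} (hf : f ≠ 0) :
    ∃ x, qeval Fq f x ≠ 0 := by
  by_contra! h
  refine hf (qeval_ext hn fun x => ?_)
  rw [h x, ← zero_smul F (0 : Fin n → F), qeval_smul, zero_mul]

/-- A nonzero code stable under `f ↦ f ^ (q ^ s)` contains a nonzero fixed element. -/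
theorem exists_qpow_eq_self (hn : Module.finrank Fq F = n) (s : ℕ) {W : Submodule F (Fin n → F)}
    (hW : powCode Fq s W = W) (h0 : W ≠ ⊥) : ∃ f ∈ W, f ≠ 0 ∧ qpow Fq s f = f := by
  classical
  let supp : (Fin n → F) → Finset F := fun f => Finset.univ.filter fun x => qeval Fq f x ≠ 0
  obtain ⟨f, ⟨hfW, hf0⟩, hmin⟩ := Set.exists_min_image {f | f ∈ W ∧ f ≠ 0}
    (fun f => (supp f).card) (Set.toFinite _) (Submodule.exists_mem_ne_zero_of_ne_bot h0)
  obtain ⟨x₀, hx₀⟩ := qeval_ne_zero hn hf0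
  set g := (qeval Fq f x₀)⁻¹ • f with hg
  have hgW : g ∈ W := W.smul_mem _ hfW
  have hgx : qeval Fq g x₀ = 1 := by rw [hg, qeval_smul, inv_mul_cancel₀ hx₀]
  refine ⟨g, hgW, smul_ne_zero (inv_ne_zero hx₀) hf0, ?_⟩
  by_contra hne
  have hdW : qpow Fq s g - g ∈ W := W.sub_mem (hW ▸ qpow_mem_powCode hgW) hgW
  refine absurd (hmin _ ⟨hdW, sub_ne_zero.2 hne⟩) (not_le.2 (Finset.card_lt_card ?_))
  refine Finset.ssubset_iff_subset_ne.2 ⟨fun x hx => ?_, fun h => ?_⟩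
  · simp only [supp, Finset.mem_filter_univ] at hx ⊢
    intro h
    apply hx
    rw [qeval_sub, qeval_qpow hn, hg, qeval_smul, h, mul_zero,
      zero_pow (pow_ne_zero _ Fintype.card_ne_zero), sub_zero]
  · have hmem : x₀ ∈ supp f := by simpa [supp] using hx₀
    rw [← h] at hmem
    simp only [supp, Finset.mem_filter_univ, qeval_sub, qeval_qpow hn, hgx] at hmem
    simp at hmem

/-- A `q`-polynomial fixed by `f ↦ f ^ (q ^ s)`, `s` coprime to `n`, has values in `Fq`. -/
theorem qrank_le_one_of_qpow_eq_self (hn : Module.finrank Fq F = n) {s : ℕ}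
    (hs : Nat.gcd s n = 1) {f : Fin n → F} (hf : qpow Fq s f = f) : qrank Fq f ≤ 1 := by
  have h : LinearMap.range (qeval Fq f) ≤ Submodule.span Fq {(1 : F)} := by
    rintro _ ⟨x, rfl⟩
    obtain ⟨c, hc⟩ := mem_range_algebraMap_of_pow_card_base_eq hn hs
      (x := qeval Fq f x) (by rw [← qeval_qpow hn, hf])
    rw [← hc, Algebra.algebraMap_eq_smul_one]
    exact Submodule.smul_mem _ _ (Submodule.mem_span_singleton_self _)
  exact (Submodule.finrank_mono h).trans (finrank_span_singleton one_ne_zero).le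

/-- A code `U` that meets `U^{[s]}` in a hyperplane and has no nonzero subcode stable under
`f ↦ f ^ (q ^ s)` is spanned by the first iterated powers of one of its elements. -/
theorem exists_eq_span_qpow_iterate (hn : Module.finrank Fq F = n) (s k : ℕ)
    (U : Submodule F (Fin n → F))
    (hU : ∀ W ≤ U, powCode Fq s W = W → W = ⊥)
    (hk : Module.finrank F U = k + 1)
    (hinf : Module.finrank F (U ⊓ powCode Fq s U : Submodule F (Fin n → F)) = k) :
    ∃ f, U = Submodule.span F (Set.range fun i : Fin (k + 1) => (qpow Fq s)^[i] f) := by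
  induction k generalizing U with
  | zero =>
    obtain ⟨f, -, hf⟩ := finrank_eq_one_iff'.1 hk
    refine ⟨f, le_antisymm (fun g hg => ?_) ?_⟩
    · obtain ⟨c, hc⟩ := hf ⟨g, hg⟩
      have hc' : c • (f : Fin n → F) = g := congrArg Subtype.val hc
      rw [← hc']
      exact Submodule.smul_mem _ _ (Submodule.subset_span ⟨0, rfl⟩)
    · rw [Submodule.span_le]
      rintro _ ⟨i, rfl⟩
      have : i = 0 := Fin.ext (by omega)
      subst this
      exact f.2
  | succ k ih =>
    set W := U ⊓ powCode Fq s U with hWdef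
    have hWU : W ≤ U := inf_le_left
    have hstab : ¬ W ≤ powCode Fq s W := by
      intro h
      have h1 := Submodule.eq_of_le_of_finrank_le h (finrank_powCode hn s W).le
      have h2 := hU W hWU h1.symm
      rw [h2, finrank_bot] at hinf
      omega
    have hW2 : Module.finrank F (W ⊓ powCode Fq s W : Submodule F (Fin n → F)) = k := by
      have h1 := Submodule.finrank_sup_add_finrank_inf_eq W (powCode Fq s W)
      have h2 : Module.finrank F (W ⊔ powCode Fq s W : Submodule F (Fin n → F)) ≤ k + 2 := by
        rw [← hk, ← finrank_powCode hn s U]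
        exact Submodule.finrank_mono (sup_le inf_le_right (powCode_mono s hWU))
      have h3 : Module.finrank F (W ⊓ powCode Fq s W : Submodule F (Fin n → F)) < k + 1 := by
        rw [← hinf]
        exact Submodule.finrank_lt_finrank_of_lt (inf_lt_left.2 hstab)
      rw [finrank_powCode hn] at h1
      omega
    obtain ⟨g, hg⟩ := ih W (fun W' h => hU W' (h.trans hWU)) hinf hW2
    have hgW : ∀ i < k + 1, (qpow Fq s)^[i] g ∈ W := fun i hi => by
      rw [hg]; exact Submodule.subset_span ⟨⟨i, hi⟩, rfl⟩
    obtain ⟨f, hfU, rfl⟩ : g ∈ powCode Fq s U := (hgW 0 (by omega)).2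
    have hfW : f ∉ W := by
      intro hfW
      apply hstab
      rw [hg, Submodule.span_le, ← hg]
      rintro _ ⟨i, rfl⟩
      refine ⟨(qpow Fq s)^[i] f, ?_, by
        simp only [← Function.iterate_succ_apply, ← Function.iterate_succ_apply']⟩
      rcases i with ⟨_ | i, hi⟩
      · exact hfW
      · exact hgW i (by omega)
    refine ⟨f, ?_⟩
    set S := Submodule.span F (Set.range fun i : Fin (k + 1 + 1) => (qpow Fq s)^[i] f) with hS
    have hfS : f ∈ S := Submodule.subset_span ⟨0, rfl⟩
    have hWS : W ≤ S := by
      rw [hg, Submodule.span_le]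
      rintro _ ⟨i, rfl⟩
      exact Submodule.subset_span ⟨i.succ, rfl⟩
    have hSU : S ≤ U := by
      rw [hS, Submodule.span_le]
      rintro _ ⟨i, rfl⟩
      rcases i with ⟨_ | i, hi⟩
      · exact hfU
      · exact hWU (hgW i (by omega))
    have hlt : W < S := lt_of_le_of_ne hWS fun h => hfW (h ▸ hfS)
    have := Submodule.finrank_lt_finrank_of_lt hlt
    exact (Submodule.eq_of_le_of_finrank_le hSU (by omega)).symm

/-- Any nonzero vector belongs to a linearly independent family of every size up to the
dimension. -/
theorem exists_linearIndependent_cons {K V : Type*} [Field K] [AddCommGroup V] [Module K V]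
    {v : V} (hv : v ≠ 0) (m : ℕ) (hm : m + 1 ≤ Module.finrank K V) :
    ∃ u : Fin m → V, LinearIndependent K (Fin.cons v u : Fin (m + 1) → V) := by
  induction m with
  | zero =>
    refine ⟨Fin.elim0, ?_⟩
    exact (linearIndependent_unique_iff (ι := Fin 1)).2 hv
  | succ m ih =>
    obtain ⟨u, hu⟩ := ih (by omega)
    obtain ⟨x, hx⟩ := exists_linearIndependent_snoc_of_lt_finrank hu (by omega)
    exact ⟨Fin.snoc u x, by rwa [Fin.cons_snoc_eq_snoc_cons]⟩

/-- In an MRD code spanned by iterated powers of `f`, the generator `f` is invertible. -/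
theorem qeval_bijective_of_span (hn : Module.finrank Fq F = n) {s k : ℕ} (hkn : k + 1 ≤ n)
    {C : Submodule F (Fin n → F)} (hdim : Module.finrank F C = k + 1)
    (hMRD : ∀ f ∈ C, f ≠ 0 → n - k ≤ qrank Fq f) {f : Fin n → F}
    (hf : C = Submodule.span F (Set.range fun i : Fin (k + 1) => (qpow Fq s)^[i] f)) :
    Function.Bijective (qeval Fq f) := by
  have hinj : Function.Injective (qeval Fq f) := by
    rw [injective_iff_map_eq_zero]
    intro v hv
    by_contra hv0
    obtain ⟨u, hu⟩ := exists_linearIndependent_cons (K := Fq) hv0 k (by omega)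
    let L : C →ₗ[F] (Fin k → F) :=
      { toFun := fun c i => qeval Fq (c : Fin n → F) (u i)
        map_add' := fun a b => funext fun i => qeval_add _ _ _
        map_smul' := fun a b => funext fun i => qeval_smul _ _ _ }
    have hker : LinearMap.ker L ≠ ⊥ := LinearMap.ker_ne_bot_of_finrank_lt (by
      rw [hdim, Module.finrank_fin_fun]; omega)
    obtain ⟨c, hc, hc0⟩ := Submodule.exists_mem_ne_zero_of_ne_bot hker
    have hcv : ∀ c ∈ C, qeval Fq c v = 0 := by
      intro c hc
      rw [hf] at hc
      induction hc using Submodule.span_induction with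
      | mem x hx =>
        obtain ⟨i, rfl⟩ := hx
        rw [qeval_qpow_iterate hn, hv, zero_pow (pow_ne_zero _ Fintype.card_ne_zero)]
      | zero => simp [qeval_apply]
      | add x y _ _ hx hy => rw [qeval_add, hx, hy, add_zero]
      | smul a x _ hx => rw [qeval_smul, hx, mul_zero]
    have hspan : Submodule.span Fq (Set.range (Fin.cons v u : Fin (k + 1) → F)) ≤
        LinearMap.ker (qeval Fq (c : Fin n → F)) := by
      rw [Submodule.span_le]
      rintro _ ⟨i, rfl⟩
      refine Fin.cases ?_ (fun j => ?_) i
      · exact hcv _ c.2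
      · exact congrFun hc j
    have h1 := Submodule.finrank_mono hspan
    rw [finrank_span_eq_card hu, Fintype.card_fin] at h1
    have h2 := LinearMap.finrank_range_add_finrank_ker (qeval Fq (c : Fin n → F))
    have h3 := hMRD c c.2 (fun h => hc0 (Subtype.ext h))
    rw [qrank] at h3
    omega
  exact Finite.injective_iff_bijective.1 hinj

theorem codeEquiv_gcode_of_span (hn : Module.finrank Fq F = n) {s k : ℕ}
    {C : Submodule F (Fin n → F)} {f : Fin n → F} (hbij : Function.Bijective (qeval Fq f))
    (hf : C = Submodule.span F (Set.range fun i : Fin k => (qpow Fq s)^[i] f)) :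
    CodeEquiv Fq (C : Set (Fin n → F)) (Gcode F n k s : Set (Fin n → F)) := by
  let e : F ≃ₗ[Fq] F := LinearEquiv.ofBijective (qeval Fq f) hbij
  obtain ⟨g, hg⟩ := qeval_surjective hn (e.symm : F →ₗ[Fq] F)
  have hone : ∀ x, qeval Fq (qmono F n 0) x = x := fun x => by rw [qeval_qmono hn]; simp
  refine ⟨qmono F n 0, g, RingEquiv.refl F, ?_, by rw [hg]; exact e.symm.bijective, ?_⟩
  · rw [show ⇑(qeval Fq (qmono F n 0)) = id from funext hone]
    exact Function.bijective_id
  · have hval : ∀ p x, qeval Fq (qcomp Fq (qmono F n 0) (qcomp Fq p g)) x =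
        qeval Fq p (e.symm x) := fun p x => by
      rw [qeval_qcomp hn, hone, qeval_qcomp hn, hg]; rfl
    let L : (Fin n → F) →ₗ[F] (Fin n → F) :=
      { toFun := fun p => qcomp Fq (qmono F n 0) (qcomp Fq p g)
        map_add' := fun a b => qeval_ext hn fun x => by
          simp only [qeval_add, hval]
        map_smul' := fun a b => qeval_ext hn fun x => by
          simp only [qeval_smul, hval, RingHom.id_apply] }
    have himg : Submodule.map L C = Gcode F n k s := by
      rw [hf, Submodule.map_span, ← Set.range_comp, Gcode]
      congr 2
      funext i
      refine qeval_ext hn fun x => ?_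
      have h1 : qeval Fq f (e.symm x) = x := e.apply_symm_apply x
      exact (hval _ x).trans (by rw [qeval_qpow_iterate hn, qeval_qmono hn, h1])
    rw [← himg]
    rfl

end PowCode

section MonomialCodes

variable {Fq F : Type*} [Field Fq] [Fintype Fq] [Field F] [Fintype F] [Algebra Fq F] {n : ℕ}

theorem eq_of_mul_mod_eq {s : ℕ} (hs : Nat.gcd s n = 1) {u v : ℕ} (hu : u < n) (hv : v < n)
    (h : s * u % n = s * v % n) : u = v :=
  Nat.ModEq.eq_of_lt_of_lt
    (Nat.ModEq.cancel_left_of_coprime (by rwa [Nat.gcd_comm]) h) hu hv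

theorem exists_mul_mod_eq {s : ℕ} (hs : Nat.gcd s n = 1) (j : Fin n) :
    ∃ u < n, s * u % n = j := by
  have hinj : Function.Injective fun u : Fin n =>
      (⟨s * u % n, Nat.mod_lt _ u.pos⟩ : Fin n) := fun u v h =>
    Fin.ext (eq_of_mul_mod_eq hs u.2 v.2 (congrArg Fin.val h))
  obtain ⟨u, hu⟩ := Finite.injective_iff_surjective.1 hinj j
  exact ⟨u, u.2, congrArg Fin.val hu⟩

theorem qmono_eq_single (hn : 0 < n) (m : ℕ) :
    qmono F n m = Pi.single (⟨m % n, Nat.mod_lt _ hn⟩ : Fin n) 1 := by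
  funext j
  simp [qmono, Pi.single_apply, Fin.ext_iff]

variable (F) in
/-- The span of the monomials `x ^ (q ^ (s * u))` with `u ∈ S`. -/
def monoSpan (n s : ℕ) (S : Finset ℕ) : Submodule F (Fin n → F) :=
  Submodule.span F (Set.range fun u : S => qmono F n (s * u))

theorem gcode_eq_monoSpan (k s : ℕ) : Gcode F n k s = monoSpan F n s (Finset.range k) := by
  rw [Gcode, monoSpan]
  congr 1
  ext p
  constructor
  · rintro ⟨i, rfl⟩
    exact ⟨⟨i, Finset.mem_range.2 i.2⟩, rfl⟩
  · rintro ⟨⟨i, hi⟩, rfl⟩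
    exact ⟨⟨i, Finset.mem_range.1 hi⟩, rfl⟩

theorem qmono_mem_monoSpan {s u : ℕ} {S : Finset ℕ} (hu : u ∈ S) :
    qmono F n (s * u) ∈ monoSpan F n s S :=
  Submodule.subset_span ⟨⟨u, hu⟩, rfl⟩

theorem mem_monoSpan {s : ℕ} (hs : Nat.gcd s n = 1) {S : Finset ℕ} (hS : ∀ u ∈ S, u < n)
    {p : Fin n → F} :
    p ∈ monoSpan F n s S ↔ ∀ u < n, u ∉ S → ∀ j : Fin n, (j : ℕ) = s * u % n → p j = 0 := by
  constructor
  · intro hp u hu huS j hj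
    rw [monoSpan] at hp
    induction hp using Submodule.span_induction with
    | mem x hx =>
      obtain ⟨⟨v, hv⟩, rfl⟩ := hx
      refine if_neg fun h => huS ?_
      rwa [eq_of_mul_mod_eq hs hu (hS v hv) (hj.symm.trans h)]
    | zero => rfl
    | add x y _ _ hx hy => rw [Pi.add_apply, hx, hy, add_zero]
    | smul a x _ hx => rw [Pi.smul_apply, hx, smul_zero]
  · intro h
    rw [pi_eq_sum_univ' p]
    refine Submodule.sum_mem _ fun j _ => ?_
    obtain ⟨u, hu, hj⟩ := exists_mul_mod_eq hs j
    by_cases huS : u ∈ S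
    · refine Submodule.smul_mem _ _ ?_
      convert qmono_mem_monoSpan (F := F) (n := n) (s := s) huS using 1
      funext i
      simp [qmono, hj, Pi.single_apply, Fin.ext_iff]
    · rw [h u hu huS j hj.symm, zero_smul]
      exact Submodule.zero_mem _

theorem finrank_monoSpan {s : ℕ} (hs : Nat.gcd s n = 1) (hn : 0 < n) {S : Finset ℕ}
    (hS : ∀ u ∈ S, u < n) : Module.finrank F (monoSpan F n s S) = S.card := by
  have hinj : Function.Injective fun u : S => (⟨s * u % n, Nat.mod_lt _ hn⟩ : Fin n) :=
    fun u v h => Subtype.ext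
      (eq_of_mul_mod_eq hs (hS u u.2) (hS v v.2) (congrArg Fin.val h))
  have hli := (Pi.basisFun F (Fin n)).linearIndependent.comp _ hinj
  rw [monoSpan, show (fun u : S => qmono F n (s * u)) =
    (Pi.basisFun F (Fin n)) ∘ fun u : S => (⟨s * u % n, Nat.mod_lt _ hn⟩ : Fin n) from
      funext fun u => by simp [qmono_eq_single hn]]
  rw [finrank_span_eq_card hli, Fintype.card_coe]

theorem qpow_qmono (hn : Module.finrank Fq F = n) (s m : ℕ) :
    qpow Fq s (qmono F n m) = qmono F n (m + s) :=
  qeval_ext hn fun x => by rw [qeval_qpow hn, qeval_qmono hn, qeval_qmono hn, pow_card_base_add]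

theorem finrank_gcode_inf_powCode (hn : Module.finrank Fq F = n) {s k : ℕ}
    (hs : Nat.gcd s n = 1) (hkn : k < n) :
    Module.finrank F (Gcode F n k s ⊓ powCode Fq s (Gcode F n k s) : Submodule F (Fin n → F)) =
      k - 1 := by
  have hpos : 0 < n := by omega
  have hk : ∀ u ∈ Finset.range k, u < n := fun u hu => by
    rw [Finset.mem_range] at hu; omega
  have hk1 : ∀ u ∈ Finset.Ico 1 (k + 1), u < n := fun u hu => by
    rw [Finset.mem_Ico] at hu; omega
  have hk2 : ∀ u ∈ Finset.Ico 1 k, u < n := fun u hu => by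
    rw [Finset.mem_Ico] at hu; omega
  rw [gcode_eq_monoSpan]
  have hpow : monoSpan F n s (Finset.Ico 1 (k + 1)) =
      powCode Fq s (monoSpan F n s (Finset.range k)) := by
    refine Submodule.eq_of_le_of_finrank_le ?_ ?_
    · rw [monoSpan, Submodule.span_le]
      rintro _ ⟨⟨u, hu⟩, rfl⟩
      rw [Finset.mem_Ico] at hu
      refine ⟨qmono F n (s * (u - 1)), qmono_mem_monoSpan (Finset.mem_range.2 (by omega)), ?_⟩
      rw [qpow_qmono hn, ← Nat.mul_succ, Nat.succ_eq_add_one, Nat.sub_add_cancel hu.1]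
    · rw [finrank_powCode hn, finrank_monoSpan hs hpos hk, finrank_monoSpan hs hpos hk1]
      simp
  have hinf : monoSpan F n s (Finset.range k) ⊓ monoSpan F n s (Finset.Ico 1 (k + 1)) =
      monoSpan F n s (Finset.Ico 1 k) := by
    ext p
    rw [Submodule.mem_inf, mem_monoSpan hs hk, mem_monoSpan hs hk1, mem_monoSpan hs hk2]
    simp only [Finset.mem_range, Finset.mem_Ico]
    constructor
    · rintro ⟨h1, h2⟩ u hu hmem
      by_cases h : u < k
      · exact h2 u hu (by omega)
      · exact h1 u hu h
    · intro h
      exact ⟨fun u hu hmem => h u hu (by omega), fun u hu hmem => h u hu (by omega)⟩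
  rw [← hpow, hinf, finrank_monoSpan hs hpos hk2, Nat.card_Ico]

theorem qcomp_qmono_apply [NeZero n] (a : Fin n → F) (m : ℕ) (j : Fin n) :
    qcomp Fq a (qmono F n m) j = a (j - Fin.ofNat n m) := by
  rw [qcomp, Finset.sum_eq_single (j - Fin.ofNat n m)]
  · simp [qmono]
  · intro i _ hi
    have : ((j - i : Fin n) : ℕ) ≠ m % n := fun h => hi (by
      rw [← show j - i = Fin.ofNat n m from Fin.ext h, sub_sub_cancel])
    simp [qmono, this]
  · simp

/-- The left idealizer of a generalized Gabidulin code consists of the scalars. -/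
theorem exists_scalar_of_qcomp_mem_gcode {s k : ℕ}
    (hs : Nat.gcd s n = 1) (hk1 : 1 ≤ k) (hkn : k < n) {a : Fin n → F}
    (ha : ∀ p ∈ Gcode F n k s, qcomp Fq a p ∈ Gcode F n k s) :
    ∃ c, ∀ x, qeval Fq a x = c * x := by
  have : NeZero n := ⟨by omega⟩
  have hk : ∀ u ∈ Finset.range k, u < n := fun u hu => by
    rw [Finset.mem_range] at hu; omega
  have hzero : ∀ t : Fin n, t ≠ 0 → a t = 0 := by
    intro t ht
    obtain ⟨u, hu, hut⟩ := exists_mul_mod_eq hs t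
    have hu0 : u ≠ 0 := fun h => ht (Fin.ext (by rw [← hut, h]; simp))
    obtain ⟨v, hv, hkuv, huvn⟩ : ∃ v < k, k ≤ u + v ∧ u + v < n := by
      by_cases h : u < k
      · exact ⟨k - u, by omega, by omega, by omega⟩
      · exact ⟨0, by omega, by omega, by omega⟩
    have hmem := ha (qmono F n (s * v)) (by
      rw [gcode_eq_monoSpan]; exact qmono_mem_monoSpan (Finset.mem_range.2 hv))
    rw [gcode_eq_monoSpan, mem_monoSpan hs hk] at hmem
    have h := hmem (u + v) huvn (by simpa using hkuv) (t + Fin.ofNat n (s * v)) (by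
      rw [Fin.val_add, ← hut]; simp [mul_add])
    rwa [qcomp_qmono_apply, add_sub_cancel_right] at h
  refine ⟨a 0, fun x => ?_⟩
  rw [qeval_apply, Finset.sum_eq_single (0 : Fin n)]
  · simp
  · intro t _ ht
    rw [hzero t ht, zero_mul]
  · simp

theorem gcode_mod (k s : ℕ) : Gcode F n k (s % n) = Gcode F n k s := by
  have h : ∀ i, qmono F n (s % n * i) = qmono F n (s * i) := fun i => by
    funext j; simp [qmono]
  simp only [Gcode, h]

theorem finrank_inf_powCode_of_codeEquiv (hn : Module.finrank Fq F = n) {s k : ℕ}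
    (hs : Nat.gcd s n = 1) (hk1 : 1 ≤ k) (hkn : k < n) {C : Submodule F (Fin n → F)}
    (hC : CodeEquiv Fq (C : Set (Fin n → F)) (Gcode F n k s : Set (Fin n → F))) :
    Module.finrank F (C ⊓ powCode Fq s C : Submodule F (Fin n → F)) = k - 1 := by
  obtain ⟨h, g, σ, hh, hg, himg⟩ := hC
  set Φ : (Fin n → F) → (Fin n → F) :=
    fun f => qcomp Fq h (qcomp Fq (fun i => σ (f i)) g) with hΦ
  have hval : ∀ f x, qeval Fq (Φ f) x = qeval Fq h (σ (qeval Fq f (σ.symm (qeval Fq g x)))) :=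
    fun f x => by rw [hΦ, qeval_qcomp hn, qeval_qcomp hn, qeval_map_ringEquiv]
  have hinj : Function.Injective Φ := by
    intro f f' hff
    refine qeval_ext hn fun x => ?_
    obtain ⟨y, hy⟩ := hg.2 (σ x)
    have := hval f y
    rw [hff, hval f' y, hy, σ.symm_apply_apply] at this
    exact (σ.injective (hh.1 this)).symm
  have hscal : ∀ a, ∃ c, ∀ x, qeval Fq h (a * x) = c * qeval Fq h x := by
    intro a
    let e : F ≃ₗ[Fq] F := LinearEquiv.ofBijective (qeval Fq h) hh
    obtain ⟨φ, hφ⟩ := qeval_surjective hn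
      ((qeval Fq h ∘ₗ LinearMap.mulLeft Fq a) ∘ₗ (e.symm : F →ₗ[Fq] F))
    have hφ' : ∀ y, qeval Fq φ (qeval Fq h y) = qeval Fq h (a * y) := fun y => by
      have : e.symm (qeval Fq h y) = y := e.symm_apply_apply y
      rw [hφ]; simp [this]
    obtain ⟨c, hc⟩ := exists_scalar_of_qcomp_mem_gcode (a := φ) hs hk1 hkn (by
      intro p hp
      rw [← SetLike.mem_coe, himg] at hp ⊢
      obtain ⟨f, hf, rfl⟩ := hp
      refine ⟨σ.symm a • f, C.smul_mem _ hf, qeval_ext hn fun x => ?_⟩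
      rw [qeval_qcomp hn φ]
      refine (hval _ x).trans (Eq.trans ?_ (congrArg (qeval Fq φ) (hval f x)).symm)
      rw [hφ', qeval_smul, map_mul, σ.apply_symm_apply])
    exact ⟨c, fun x => by rw [← hφ', hc]⟩
  set b := qeval Fq h 1 with hb
  have hb0 : b ≠ 0 := fun h0 => one_ne_zero (hh.1 (h0.trans (map_zero _).symm))
  have hmul : ∀ a x, qeval Fq h (a * x) = qeval Fq h a / b * qeval Fq h x := by
    intro a x
    obtain ⟨c, hc⟩ := hscal a
    have h1 := hc 1
    rw [mul_one] at h1
    rw [hc x, h1, mul_div_assoc, div_self hb0, mul_one]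
  have hpow : ∀ (y : F) (m : ℕ), qeval Fq h (y ^ m) = b / b ^ m * qeval Fq h y ^ m := by
    intro y m
    induction m with
    | zero => simp [hb]
    | succ m ih =>
      rw [pow_succ', hmul, ih]
      field_simp
      ring
  have hcomm : ∀ f, Φ (qpow Fq s f) =
      (b / b ^ Fintype.card Fq ^ s) • qpow Fq s (Φ f) := fun f => qeval_ext hn fun x => by
    rw [hval, qeval_qpow hn, map_pow, hpow, qeval_smul, qeval_qpow hn, hval]
  have himgpow : Φ '' (powCode Fq s C : Set (Fin n → F)) =
      (powCode Fq s (Gcode F n k s) : Set (Fin n → F)) := by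
    refine Set.eq_of_subset_of_ncard_le ?_ ?_ (Set.toFinite _)
    · rintro _ ⟨_, ⟨f, hf, rfl⟩, rfl⟩
      rw [hcomm]
      refine Submodule.smul_mem _ _ (qpow_mem_powCode ?_)
      rw [← SetLike.mem_coe, himg]
      exact ⟨f, hf, rfl⟩
    · change (qpow Fq s '' (Gcode F n k s : Set (Fin n → F))).ncard ≤
        (Φ '' (qpow Fq s '' (C : Set (Fin n → F)))).ncard
      rw [Set.ncard_image_of_injective _ hinj, Set.ncard_image_of_injective _ (qpow_injective hn s),
        Set.ncard_image_of_injective _ (qpow_injective hn s), himg,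
        Set.ncard_image_of_injective _ hinj]
  rw [← finrank_gcode_inf_powCode hn hs hkn]
  apply finrank_eq_of_ncard_eq
  rw [Submodule.coe_inf, Submodule.coe_inf, ← himgpow, himg, ← Set.image_inter hinj,
    Set.ncard_image_of_injective _ hinj]

end MonomialCodes

/-- An `F`-linear MRD code `C` of `q`-polynomials over `F`, `[F : Fq] = n`, of dimension `k` with
`1 ≤ k ≤ n - 1`, is equivalent to a generalized Gabidulin code iff
`dim (C ∩ C^{[s]}) = k - 1` for some `s < n` coprime to `n`. -/
theorem gabidulin_characterization
    (Fq F : Type*) [Field Fq] [Fintype Fq] [Field F] [Fintype F] [Algebra Fq F]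
    (n k : ℕ) (hn : Module.finrank Fq F = n) (hk1 : 1 ≤ k) (hkn : k ≤ n - 1)
    (C : Submodule F (Fin n → F))
    (hdim : Module.finrank F C = k)
    (hMRD : ∀ f ∈ C, f ≠ 0 → n - k + 1 ≤ qrank Fq f) :
    (∃ s : ℕ, Nat.gcd s n = 1 ∧
      CodeEquiv Fq (C : Set (Fin n → F)) (Gcode F n k s : Set (Fin n → F))) ↔
    (∃ s : ℕ, s < n ∧ Nat.gcd s n = 1 ∧
      Module.finrank F (C ⊓ powCode Fq s C : Submodule F (Fin n → F)) = k - 1) := by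
  have hn2 : k < n := by omega
  constructor
  · rintro ⟨s, hs, hC⟩
    have hs' : Nat.gcd (s % n) n = 1 := by rw [← Nat.gcd_rec, Nat.gcd_comm, hs]
    rw [← gcode_mod] at hC
    exact ⟨s % n, Nat.mod_lt _ (by omega), hs',
      finrank_inf_powCode_of_codeEquiv hn hs' hk1 hn2 hC⟩
  · rintro ⟨s, -, hs, hinf⟩
    refine ⟨s, hs, ?_⟩
    obtain ⟨k, rfl⟩ : ∃ m, k = m + 1 := ⟨k - 1, by omega⟩
    have hstab : ∀ W ≤ C, powCode Fq s W = W → W = ⊥ := by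
      intro W hWC hW
      by_contra h0
      obtain ⟨f, hfW, hf0, hf⟩ := exists_qpow_eq_self hn s hW h0
      have h1 := hMRD f (hWC hfW) hf0
      have h2 := qrank_le_one_of_qpow_eq_self hn hs hf
      omega
    obtain ⟨f, hf⟩ := exists_eq_span_qpow_iterate hn s k C hstab hdim hinf
    exact codeEquiv_gcode_of_span hn (qeval_bijective_of_span hn hn2.le hdim
      (fun p hp hp0 => le_trans (by omega) (hMRD p hp hp0)) hf) hf
end
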